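/- For every η > 0 there exists an integer n₀ such that every regular tournament on n ≥ n₀ vertices contains at least (1/2 − η)n pairwise edge-disjoint Hamilton cycles. -/

import Mathlib

open scoped Classical

/-- Outdegree of a vertex in a digraph given as a relation. -/
noncomputable def outDeg {V : Type*} [Fintype V] (G : V → V → Prop) (v : V) : ℕ :=
  (Finset.univ.filter fun u => G v u).card

/-- Indegree of a vertex in a digraph given as a relation. -/
noncomputable def inDeg {V : Type*} [Fintype V] (G : V → V → Prop) (v : V) : ℕ :=
  (Finset.univ.filter fun u => G u v).card

/-- A Hamilton cycle of a digraph `G`, encoded as a permutation which is a single cycle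
moving every vertex, all of whose transition edges lie in `G`. -/
def IsHamCycle {V : Type*} [Fintype V] [DecidableEq V] (G : V → V → Prop)
    (σ : Equiv.Perm V) : Prop :=
  σ.IsCycle ∧ (∀ v, σ v ≠ v) ∧ (∀ v, G v (σ v))

open MeasureTheory ProbabilityTheory in
/-- **Hoeffding + union bound**: if the number of constraints is small, some function `f : I → L`
keeps all the sums `∑ i, a j i (f i)` below their averages plus `t`. -/
theorem exists_forall_sum_le_average_add {I L J : Type*} [Fintype I] [Fintype L] [Nonempty L]
    [Fintype J] (a : J → I → L → ℝ) (h0 : ∀ j i l, 0 ≤ a j i l) (h1 : ∀ j i l, a j i l ≤ 1)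
    {t : ℝ} (ht : 0 ≤ t)
    (hJ : (Fintype.card J : ℝ) * Real.exp (-2 * t ^ 2 / Fintype.card I) < 1) :
    ∃ f : I → L, ∀ j, ∑ i, a j i (f i) ≤ ∑ i, (∑ l, a j i l) / Fintype.card L + t := by
  let _ : MeasurableSpace L := ⊤
  let ν : Measure L := (PMF.uniformOfFintype L).toMeasure
  let μ : Measure (I → L) := Measure.pi fun _ => ν
  have hprob : IsProbabilityMeasure μ := inferInstance
  have hint : ∀ g : L → ℝ, ∫ l, g l ∂ν = (∑ l, g l) / Fintype.card L := by
    intro g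
    rw [PMF.integral_eq_sum]
    simp [Finset.mul_sum, div_eq_inv_mul]
  have hmeas : ∀ g : L → ℝ, Measurable g := fun g => measurable_from_top
  have key : ∀ j, μ.real {f | t ≤ ∑ i, (a j i (f i) - (∑ l, a j i l) / Fintype.card L)}
      ≤ Real.exp (-2 * t ^ 2 / Fintype.card I) := by
    intro j
    have hind : iIndepFun (fun i (f : I → L) => a j i (f i) - (∑ l, a j i l) / Fintype.card L) μ :=
      iIndepFun_pi (X := fun i l => a j i l - (∑ l, a j i l) / Fintype.card L)
        fun i => (hmeas _).aemeasurable
    have hsub : ∀ i ∈ (Finset.univ : Finset I), HasSubgaussianMGF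
        (fun f : I → L => a j i (f i) - (∑ l, a j i l) / Fintype.card L)
          ((‖(1 : ℝ) - 0‖₊ / 2) ^ 2) μ := by
      intro i _
      have hm : Measure.map (fun f : I → L => f i) μ = ν :=
        (measurePreserving_eval (fun _ => ν) i).map_eq
      have := hasSubgaussianMGF_of_mem_Icc (X := a j i) (μ := ν) (a := 0) (b := 1)
        (hmeas _).aemeasurable (Filter.Eventually.of_forall fun l => ⟨h0 j i l, h1 j i l⟩)
      rw [hint, ← hm] at this
      exact HasSubgaussianMGF.of_map (Y := fun f : I → L => f i)
        (measurable_pi_apply i).aemeasurable this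
    have := HasSubgaussianMGF.measure_sum_ge_le_of_iIndepFun hind hsub ht
    refine this.trans (le_of_eq ?_)
    congr 1
    simp
    rcases Nat.eq_zero_or_pos (Fintype.card I) with h | h
    · simp [h]
    · field_simp
  by_contra! hcon
  have hcov : (Set.univ : Set (I → L)) ⊆
      ⋃ j ∈ (Finset.univ : Finset J),
        {f | t ≤ ∑ i, (a j i (f i) - (∑ l, a j i l) / Fintype.card L)} := by
    intro f _
    obtain ⟨j, hj⟩ := hcon f
    simp only [Set.mem_iUnion, Set.mem_ofPred_eq]
    refine ⟨j, Finset.mem_univ _, ?_⟩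
    rw [Finset.sum_sub_distrib]
    linarith
  have h2 : (1 : ℝ) ≤ ∑ j : J, Real.exp (-2 * t ^ 2 / Fintype.card I) := by
    calc (1 : ℝ) = μ.real Set.univ := by simp
      _ ≤ μ.real _ := measureReal_mono hcov (measure_ne_top _ _)
      _ ≤ ∑ j : J, μ.real _ := measureReal_biUnion_finset_le _ _
      _ ≤ _ := Finset.sum_le_sum fun j _ => key j
  simp at h2
  simp at hJ
  linarith

theorem exists_perm_pos_of_sum_eq {N : Type*} [Fintype N] {Δ : ℕ} (hΔ : 0 < Δ)
    (M : N → N → ℕ) (hr : ∀ i, ∑ j, M i j = Δ) (hc : ∀ j, ∑ i, M i j = Δ) :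
    ∃ σ : Equiv.Perm N, ∀ i, 0 < M i (σ i) := by
  obtain ⟨M', hM', hMM⟩ := (exists_mem_doublyStochastic_eq_smul_iff (R := ℚ) (s := (Δ : ℚ))
    (M := fun i j => (M i j : ℚ)) (by positivity)).2
    ⟨fun i j => by positivity, fun i => by exact_mod_cast hr i, fun j => by exact_mod_cast hc j⟩
  obtain ⟨w, hw0, hw1, hw⟩ := exists_eq_sum_perm_of_mem_doublyStochastic hM'
  obtain ⟨σ, hσ⟩ : ∃ σ, 0 < w σ := by
    by_contra! h
    have : ∑ σ, w σ ≤ 0 := Finset.sum_nonpos fun σ _ => h σ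
    linarith
  refine ⟨σ, fun i => ?_⟩
  have h1 : w σ ≤ M' i (σ i) := by
    rw [← hw, Matrix.sum_apply]
    refine le_trans (le_of_eq ?_) (Finset.single_le_sum (f := fun τ : Equiv.Perm N =>
      (w τ • τ.permMatrix ℚ) i (σ i)) (fun τ _ => ?_) (Finset.mem_univ σ))
    · simp [Equiv.toPEquiv_apply]
    · simp only [Matrix.smul_apply, PEquiv.toMatrix_apply, smul_eq_mul]
      split_ifs <;> simp [hw0]
  have h2 : (M i (σ i) : ℚ) = Δ * M' i (σ i) := by
    have := congrFun (congrFun hMM i) (σ i)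
    simpa using this
  have : (0 : ℚ) < M i (σ i) := by
    rw [h2]
    have : (0 : ℚ) < Δ := by exact_mod_cast hΔ
    have : 0 < M' i (σ i) := by linarith
    positivity
  exact_mod_cast this

theorem exists_perms_cover {N : Type*} [Fintype N] (Δ : ℕ)
    (M : N → N → ℕ) (hr : ∀ i, ∑ j, M i j = Δ) (hc : ∀ j, ∑ i, M i j = Δ) :
    ∃ σ : Fin Δ → Equiv.Perm N, ∀ i j, 0 < M i j → ∃ c, σ c i = j := by
  induction Δ generalizing M with
  | zero =>
    refine ⟨fun _ => 1, fun i j h => ?_⟩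
    have := hr i
    rw [Finset.sum_eq_zero_iff] at this
    have := this j (Finset.mem_univ _)
    omega
  | succ Δ ih =>
    obtain ⟨σ, hσ⟩ := exists_perm_pos_of_sum_eq (Nat.succ_pos Δ) M hr hc
    have hsplit : ∀ i j, M i j = (M i j - if σ i = j then 1 else 0) + if σ i = j then 1 else 0 := by
      intro i j
      split_ifs with h
      · subst h
        have := hσ i
        omega
      · simp
    obtain ⟨ρ, hρ⟩ := ih (fun i j => M i j - if σ i = j then 1 else 0)
      (fun i => by
        have := hr i
        rw [Finset.sum_congr rfl fun j _ => hsplit i j, Finset.sum_add_distrib] at this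
        simpa using this)
      (fun j => by
        have := hc j
        rw [Finset.sum_congr rfl fun i _ => hsplit i j, Finset.sum_add_distrib] at this
        have h1 : ∑ i, (if σ i = j then 1 else 0) = 1 := by
          simp [← Equiv.eq_symm_apply]
        omega)
    refine ⟨Fin.cons σ ρ, fun i j h => ?_⟩
    by_cases hij : σ i = j
    · exact ⟨0, by simpa using hij⟩
    · obtain ⟨c, hc⟩ := hρ i j (by simpa [hij] using h)
      exact ⟨c.succ, by simpa using hc⟩

/-- **König's edge colouring theorem** for bipartite graphs given as relations on `V × V`. -/
theorem exists_proper_edge_coloring {V C : Type*} [Fintype V] [Fintype C] [Nonempty C]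
    (R : V → V → Prop)
    (hout : ∀ u, (Finset.univ.filter fun w => R u w).card ≤ Fintype.card C)
    (hin : ∀ w, (Finset.univ.filter fun u => R u w).card ≤ Fintype.card C) :
    ∃ col : V → V → C, (∀ u w w', R u w → R u w' → col u w = col u w' → w = w') ∧
      (∀ u u' w, R u w → R u' w → col u w = col u' w → u = u') := by
  let A : V → V → ℕ := fun u w => if R u w then 1 else 0
  let M : V ⊕ V → V ⊕ V → ℕ := Sum.elim
    (fun u => Sum.elim (fun w => A u w) (fun u' => if u = u' then
      Fintype.card C - ∑ w, A u w else 0))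
    (fun w => Sum.elim (fun w' => if w = w' then Fintype.card C - ∑ u, A u w else 0)
      (fun u => A u w))
  have h1 : ∀ u, ∑ w, A u w ≤ Fintype.card C := fun u => by simpa [A] using hout u
  have h2 : ∀ w, ∑ u, A u w ≤ Fintype.card C := fun w => by simpa [A] using hin w
  obtain ⟨σ, hσ⟩ := exists_perms_cover (Fintype.card C) M
    (by
      rintro (u | w)
      · have := h1 u
        simp only [M, Fintype.sum_sum_type, Sum.elim_inl, Sum.elim_inr, Finset.sum_ite_eq,
          Finset.mem_univ, if_true]
        omega
      · have := h2 w
        simp only [M, Fintype.sum_sum_type, Sum.elim_inl, Sum.elim_inr, Finset.sum_ite_eq,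
          Finset.mem_univ, if_true]
        omega)
    (by
      rintro (u | w)
      · have := h2 u
        simp only [M, Fintype.sum_sum_type, Sum.elim_inl, Sum.elim_inr, Finset.sum_ite_eq',
          Finset.mem_univ, if_true]
        omega
      · have := h1 w
        simp only [M, Fintype.sum_sum_type, Sum.elim_inl, Sum.elim_inr, Finset.sum_ite_eq',
          Finset.mem_univ, if_true]
        omega)
  have h3 : ∀ u w, ∃ c : C, R u w → σ (Fintype.equivFin C c) (Sum.inl u) = Sum.inl w := by
    intro u w
    by_cases h : R u w
    · obtain ⟨c, hc⟩ := hσ (Sum.inl u) (Sum.inl w) (by simp [M, A, h])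
      exact ⟨(Fintype.equivFin C).symm c, fun _ => by simpa using hc⟩
    · exact ⟨Classical.arbitrary C, fun h' => absurd h' h⟩
  choose col hcol using h3
  refine ⟨col, fun u w w' hw hw' h => ?_, fun u u' w hu hu' h => ?_⟩
  · have a := hcol u w hw
    have b := hcol u w' hw'
    rw [h, b] at a
    exact (Sum.inl_injective a).symm
  · have a := hcol u w hu
    have b := hcol u' w hu'
    rw [h, ← b] at a
    exact Sum.inl_injective ((σ _).injective a)

/-- Inserting a fixed point `v` into a cycle right after `x`. -/
theorem Equiv.Perm.IsCycleOn.mul_swap_insert {V : Type*} {σ : Equiv.Perm V} {W : Set V}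
    (h : σ.IsCycleOn W) {x v : V} (hx : x ∈ W) (hv : v ∉ W) (hσv : σ v = v) :
    (σ * Equiv.swap x v).IsCycleOn (insert v W) := by
  have hxv : x ≠ v := fun h => hv (h ▸ hx)
  set ρ := σ * Equiv.swap x v with hρ
  have hρx : ρ x = v := by simp [hρ, hσv]
  have hρv : ρ v = σ x := by simp [hρ]
  have hρo : ∀ y, y ≠ x → y ≠ v → ρ y = σ y := fun y h1 h2 => by
    simp [hρ, Equiv.swap_apply_of_ne_of_ne h1 h2]
  have step : ∀ y ∈ W, ρ.SameCycle y (σ y) := by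
    intro y hy
    by_cases hyx : y = x
    · subst hyx
      refine ⟨2, ?_⟩
      rw [zpow_two, Equiv.Perm.mul_apply, hρx, hρv]
    · exact ⟨1, by rw [zpow_one, hρo y hyx (fun h => hv (h ▸ hy))]⟩
  have hmem : ∀ n : ℕ, ∀ y ∈ W, (σ ^ n) y ∈ W ∧ ρ.SameCycle y ((σ ^ n) y) := by
    intro n y hy
    induction n with
    | zero => exact ⟨by simpa using hy, by simpa using Equiv.Perm.SameCycle.refl _ _⟩
    | succ n ih =>
      rw [pow_succ', Equiv.Perm.mul_apply]
      exact ⟨h.1.mapsTo ih.1, ih.2.trans (step _ ih.1)⟩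
  have hneg : ∀ n : ℕ, ∀ y ∈ W, ((σ⁻¹) ^ n) y ∈ W := by
    intro n y hy
    induction n with
    | zero => simpa using hy
    | succ n ih =>
      rw [pow_succ', Equiv.Perm.mul_apply]
      exact h.1.perm_inv.mapsTo ih
  have hW : ∀ y ∈ W, ∀ z ∈ W, ρ.SameCycle y z := by
    intro y hy z hz
    obtain ⟨n, rfl⟩ := h.2 hy hz
    rcases Int.eq_nat_or_neg n with ⟨m, rfl | rfl⟩
    · simpa using (hmem m y hy).2
    · have h1 := (hmem m _ (hneg m y hy)).2
      simp only [← Equiv.Perm.mul_apply, inv_pow, mul_inv_cancel, Equiv.Perm.one_apply] at h1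
      simpa using h1.symm
  have hv' : ∀ y ∈ W, ρ.SameCycle v y := fun y hy => by
    have : ρ.SameCycle x v := ⟨1, by simp [hρx]⟩
    exact this.symm.trans (hW x hx y hy)
  refine ⟨⟨?_, ρ.injective.injOn, ?_⟩, ?_⟩
  · rintro y (rfl | hy)
    · rw [hρv]; exact Or.inr (h.1.mapsTo hx)
    · by_cases hyx : y = x
      · subst hyx; rw [hρx]; exact Or.inl rfl
      · rw [hρo y hyx (fun h => hv (h ▸ hy))]; exact Or.inr (h.1.mapsTo hy)
  · rintro y (rfl | hy)
    · exact ⟨x, Or.inr hx, hρx⟩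
    · obtain ⟨z, hz, rfl⟩ := h.1.surjOn hy
      by_cases hzx : z = x
      · subst hzx; exact ⟨v, Or.inl rfl, hρv⟩
      · exact ⟨z, Or.inr hz, hρo z hzx (fun h => hv (h ▸ hz))⟩
  · rintro y (rfl | hy) z (rfl | hz)
    · exact Equiv.Perm.SameCycle.refl _ _
    · exact hv' z hz
    · exact (hv' y hy).symm
    · exact hW y hy z hz

/-- Inserting a family of fixed points `v ∈ U` after distinct points `host v` of a cycle. -/
theorem exists_isCycleOn_insert_family {V : Type*} {σ : Equiv.Perm V} {W : Finset V}
    (h : σ.IsCycleOn (W : Set V)) (hfix : ∀ v ∉ W, σ v = v) (U : Finset V) (hU : Disjoint W U)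
    (host : V → V) (hhost : ∀ v ∈ U, host v ∈ W) (hinj : Set.InjOn host (U : Set V)) :
    ∃ ρ : Equiv.Perm V, ρ.IsCycleOn ((W ∪ U : Finset V) : Set V) ∧ (∀ v ∉ W ∪ U, ρ v = v) ∧
      (∀ v ∈ U, ρ (host v) = v ∧ ρ v = σ (host v)) ∧
      (∀ x ∈ W, (∀ v ∈ U, host v ≠ x) → ρ x = σ x) := by
  induction U using Finset.induction_on with
  | empty => exact ⟨σ, by simpa using h, by simpa using hfix, by simp, by simp⟩
  | insert a U ha ih =>
    rw [Finset.disjoint_insert_right] at hU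
    obtain ⟨ρ, h1, h2, h3, h4⟩ := ih hU.2 (fun v hv => hhost v (Finset.mem_insert_of_mem hv))
      (hinj.mono (by simp))
    have haW : a ∉ W ∪ U := by simp [hU.1, ha]
    have hhW := hhost a (Finset.mem_insert_self _ _)
    have hne : ∀ v ∈ U, host v ≠ host a := fun v hv he => ha <| by
      have := hinj (by simp [hv]) (by simp) he
      exact this ▸ hv
    have hxa : ρ (host a) = σ (host a) := h4 _ hhW hne
    have hb := h1.mul_swap_insert (x := host a) (v := a) (by simp [hhW]) (by simpa using haW)
      (h2 a haW)
    refine ⟨ρ * Equiv.swap (host a) a, by simpa using hb, ?_, ?_, ?_⟩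
    · intro v hv
      have hva : v ≠ a := fun h => hv (by simp [h])
      have hvU : v ∉ W ∪ U := fun h => hv (by simp at h ⊢; tauto)
      have hvh : v ≠ host a := fun h => hvU (by simp [h, hhW])
      simp [Equiv.swap_apply_of_ne_of_ne hvh hva, h2 v hvU]
    · intro v hv
      rcases Finset.mem_insert.1 hv with rfl | hv
      · exact ⟨by simp [h2 _ haW], by simp [hxa]⟩
      · have h5 : host v ≠ a := fun h => haW (by
          have := hhost v (Finset.mem_insert_of_mem hv); simp [← h, this])
        have h6 : v ≠ host a := fun h => Finset.disjoint_left.1 hU.2 hhW (h ▸ hv)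
        have h7 : v ≠ a := fun h => ha (h ▸ hv)
        simp [Equiv.swap_apply_of_ne_of_ne (hne v hv) h5, Equiv.swap_apply_of_ne_of_ne h6 h7,
          h3 v hv]
    · intro x hx hxh
      have h5 : x ≠ host a := (hxh a (Finset.mem_insert_self _ _)).symm
      have h6 : x ≠ a := fun h => hU.1 (h ▸ hx)
      simp [Equiv.swap_apply_of_ne_of_ne h5 h6,
        h4 x hx fun v hv => hxh v (Finset.mem_insert_of_mem hv)]

/-- A partial injection that increases a rank function extends to a cyclic permutation. -/
theorem exists_isCycleOn_extending {V : Type*} (W : Finset V) (F : V → V → Prop) (r : V → ℕ)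
    (hF : ∀ u w w', F u w → F u w' → w = w') (hF' : ∀ u u' w, F u w → F u' w → u = u')
    (hr : ∀ u w, F u w → r u < r w) :
    ∃ σ : Equiv.Perm V, σ.IsCycleOn (W : Set V) ∧ (∀ v ∉ W, σ v = v) ∧
      ∀ u ∈ W, ∀ w ∈ W, F u w → σ u = w := by
  induction W using Finset.induction_on_max_value r with
  | empty => exact ⟨1, by simp, by simp, by simp⟩
  | insert a W ha hmax ih =>
    obtain ⟨σ, h1, h2, h3⟩ := ih
    have hout : ∀ w ∈ insert a W, ¬ F a w := by
      intro w hw hf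
      have := hr _ _ hf
      rcases Finset.mem_insert.1 hw with rfl | hw
      · omega
      · have := hmax w hw; omega
    rcases W.eq_empty_or_nonempty with rfl | hne
    · refine ⟨σ, by simpa using h2 a (by simp), fun v _ => h2 v (by simp), ?_⟩
      intro u hu w hw hf
      have : u = a := by simpa using hu
      subst this
      exact absurd hf (hout w hw)
    obtain ⟨x, hx, hxF⟩ : ∃ x ∈ W, (∀ w ∈ W, ¬ F x w) ∧ ∀ u ∈ W, F u a → u = x := by
      by_cases hp : ∃ u ∈ W, F u a
      · obtain ⟨u, hu, hua⟩ := hp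
        exact ⟨u, hu, fun w hw hf => ha (hF _ _ _ hua hf ▸ hw), fun u' _ h => hF' _ _ _ h hua⟩
      · obtain ⟨x, hx, hmx⟩ := W.exists_max_image r hne
        refine ⟨x, hx, fun w hw hf => ?_, fun u hu hf => absurd ⟨u, hu, hf⟩ hp⟩
        have := hr _ _ hf
        have := hmx w hw
        omega
    have hxa : x ≠ a := fun h => ha (h ▸ hx)
    have hb := h1.mul_swap_insert (x := x) (v := a) (by simpa using hx) (by simpa using ha)
      (h2 a ha)
    refine ⟨σ * Equiv.swap x a, by simpa using hb, ?_, ?_⟩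
    · intro v hv
      have hva : v ≠ a := fun h => hv (by simp [h])
      have hvW : v ∉ W := fun h => hv (by simp [h])
      have hvx : v ≠ x := fun h => hvW (h ▸ hx)
      simp [Equiv.swap_apply_of_ne_of_ne hvx hva, h2 v hvW]
    · intro u hu w hw hf
      rcases Finset.mem_insert.1 hu with rfl | huW
      · exact absurd hf (hout w hw)
      have hua : u ≠ a := fun h => ha (h ▸ huW)
      rcases Finset.mem_insert.1 hw with rfl | hwW
      · rw [hxF.2 u huW hf]
        simp [h2 _ ha]
      · have hux : u ≠ x := by
          rintro rfl
          exact hxF.1 w hwW hf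
        simp [Equiv.swap_apply_of_ne_of_ne hux hua, h3 u huW w hwW hf]

/-- Greedy choice with a pairwise conflict relation. -/
theorem exists_choice_without_conflicts {T Ω : Type*} [Fintype T] (cand : T → Finset Ω)
    (conf : T → Ω → T → Ω → Prop) (b : T → T → ℕ)
    (hsymm : ∀ τ ω τ' ω', conf τ ω τ' ω' → conf τ' ω' τ ω)
    (hb : ∀ τ τ' ω', ((cand τ).filter fun ω => conf τ' ω' τ ω).card ≤ b τ τ')
    (hsum : ∀ τ, ∑ τ', b τ τ' < (cand τ).card) :
    ∃ g : T → Ω, (∀ τ, g τ ∈ cand τ) ∧ ∀ τ τ', τ ≠ τ' → ¬ conf τ (g τ) τ' (g τ') := by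
  have main : ∀ S : Finset T, ∃ g : T → Ω, (∀ τ, g τ ∈ cand τ) ∧
      ∀ τ ∈ S, ∀ τ' ∈ S, τ ≠ τ' → ¬ conf τ (g τ) τ' (g τ') := by
    intro S
    induction S using Finset.induction_on with
    | empty =>
      have : ∀ τ, ∃ ω, ω ∈ cand τ := fun τ =>
        Finset.card_pos.1 (lt_of_le_of_lt (Nat.zero_le _) (hsum τ))
      choose g hg using this
      exact ⟨g, hg, by simp⟩
    | insert a S ha ih =>
      obtain ⟨g, hg, hgS⟩ := ih
      obtain ⟨ω, hω, hωS⟩ : ∃ ω ∈ cand a, ∀ τ' ∈ S, ¬ conf τ' (g τ') a ω := by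
        by_contra! hcon
        have hsub : cand a ⊆ Finset.univ.biUnion fun τ' =>
            (cand a).filter fun ω => conf τ' (g τ') a ω := by
          intro ω hω
          obtain ⟨τ', _, h⟩ := hcon ω hω
          simp only [Finset.mem_biUnion, Finset.mem_univ, true_and, Finset.mem_filter]
          exact ⟨τ', hω, h⟩
        have := (Finset.card_le_card hsub).trans (Finset.card_biUnion_le.trans
          (Finset.sum_le_sum fun τ' _ => hb a τ' (g τ')))
        exact absurd (hsum a) (not_lt.2 this)
      have hSa : ∀ τ ∈ S, τ ≠ a := fun τ hτ h => ha (h ▸ hτ)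
      refine ⟨Function.update g a ω, fun τ => ?_, ?_⟩
      · by_cases h : τ = a
        · subst h; simpa using hω
        · simpa [h] using hg τ
      · intro τ hτ τ' hτ' hne
        rcases Finset.mem_insert.1 hτ with rfl | hτS <;> rcases Finset.mem_insert.1 hτ' with
          rfl | hτS'
        · exact absurd rfl hne
        · rw [Function.update_self, Function.update_of_ne hne.symm]
          exact fun h => hωS τ' hτS' (hsymm _ _ _ _ h)
        · rw [Function.update_self, Function.update_of_ne hne]
          exact hωS τ hτS
        · rw [Function.update_of_ne (hSa _ hτS), Function.update_of_ne (hSa _ hτS')]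
          exact hgS τ hτS τ' hτS' hne
  obtain ⟨g, hg, h⟩ := main Finset.univ
  exact ⟨g, hg, fun τ τ' => h τ (Finset.mem_univ _) τ' (Finset.mem_univ _)⟩

/-- A cycle on `W` is extended to a cycle on all vertices: the edges leaving `X` are replaced by
paths of length three through `a x` and `b x`, the remaining vertices `v` are inserted after
`h v`. -/
theorem exists_spanning_cycle {V : Type*} [Fintype V] [Nonempty V] {σ : Equiv.Perm V} {W : Finset V}
    (hσ : σ.IsCycleOn (W : Set V)) (hfix : ∀ v ∉ W, σ v = v) (X : Finset V) (hX : X ⊆ W)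
    (a b : V → V) (ha : Set.InjOn a X) (hb : Set.InjOn b X) (haW : ∀ x ∈ X, a x ∉ W)
    (hbW : ∀ x ∈ X, b x ∉ W) (hab : ∀ x ∈ X, ∀ y ∈ X, a x ≠ b y)
    (h : V → V) (hh : ∀ v ∉ W, h v ∈ W ∧ h v ∉ X) (hinj : Set.InjOn h {v | v ∉ W}) :
    ∃ ρ : Equiv.Perm V, ρ.IsCycleOn Set.univ ∧ ∀ z,
      (z ∈ W ∧ z ∉ X ∧ ρ z = σ z) ∨ (z ∈ X ∧ ρ z = a z) ∨ (∃ x ∈ X, z = a x ∧ ρ z = b x) ∨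
      (∃ x ∈ X, z = b x ∧ ρ z = σ x) ∨ (∃ v ∉ W, z = h v ∧ ρ z = v) ∨
      (∃ v ∉ W, z = v ∧ ρ z = σ (h v)) := by
  have hia : ∀ x ∈ X, Function.invFunOn a (X : Set V) (a x) = x :=
    fun x hx => ha.leftInvOn_invFunOn hx
  have hib : ∀ x ∈ X, Function.invFunOn b (X : Set V) (b x) = x :=
    fun x hx => hb.leftInvOn_invFunOn hx
  obtain ⟨ρ₁, c1, f1, e1, o1⟩ := exists_isCycleOn_insert_family hσ hfix (X.image a)
    (by
      rw [Finset.disjoint_right]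
      intro v hv
      obtain ⟨x, hx, rfl⟩ := Finset.mem_image.1 hv
      exact haW x hx)
    (Function.invFunOn a X)
    (by
      intro v hv
      obtain ⟨x, hx, rfl⟩ := Finset.mem_image.1 hv
      rw [hia x hx]; exact hX hx)
    (by
      intro v hv w hw hvw
      obtain ⟨x, hx, rfl⟩ := Finset.mem_image.1 hv
      obtain ⟨y, hy, rfl⟩ := Finset.mem_image.1 hw
      rw [hia x hx, hia y hy] at hvw
      rw [hvw])
  have e1' : ∀ x ∈ X, ρ₁ x = a x ∧ ρ₁ (a x) = σ x := fun x hx => by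
    have := e1 (a x) (Finset.mem_image_of_mem _ hx)
    rwa [hia x hx] at this
  have o1' : ∀ x ∈ W, x ∉ X → ρ₁ x = σ x := fun x hx hxX => o1 x hx fun v hv => by
    obtain ⟨y, hy, rfl⟩ := Finset.mem_image.1 hv
    rw [hia y hy]; rintro rfl; exact hxX hy
  obtain ⟨ρ₂, c2, f2, e2, o2⟩ := exists_isCycleOn_insert_family c1 f1 (X.image b)
    (by
      rw [Finset.disjoint_right]
      intro v hv
      obtain ⟨x, hx, rfl⟩ := Finset.mem_image.1 hv
      simp only [Finset.mem_union, Finset.mem_image, not_or, not_exists, not_and]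
      exact ⟨hbW x hx, fun y hy => hab y hy x hx⟩)
    (fun v => a (Function.invFunOn b X v))
    (by
      intro v hv
      obtain ⟨x, hx, rfl⟩ := Finset.mem_image.1 hv
      rw [hib x hx]; exact Finset.mem_union_right _ (Finset.mem_image_of_mem _ hx))
    (by
      intro v hv w hw hvw
      obtain ⟨x, hx, rfl⟩ := Finset.mem_image.1 hv
      obtain ⟨y, hy, rfl⟩ := Finset.mem_image.1 hw
      simp only [hib x hx, hib y hy] at hvw
      rw [ha hx hy hvw])
  have e2' : ∀ x ∈ X, ρ₂ (a x) = b x ∧ ρ₂ (b x) = σ x := fun x hx => by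
    have := e2 (b x) (Finset.mem_image_of_mem _ hx)
    simp only [hib x hx] at this
    rwa [(e1' x hx).2] at this
  have o2' : ∀ x ∈ W, ρ₂ x = ρ₁ x := fun x hx => o2 x (Finset.mem_union_left _ hx) fun v hv => by
    obtain ⟨y, hy, rfl⟩ := Finset.mem_image.1 hv
    rw [hib y hy]; rintro rfl; exact haW y hy hx
  obtain ⟨ρ, c3, -, e3, o3⟩ := exists_isCycleOn_insert_family c2 f2 ((W ∪ X.image a) ∪ X.image b)ᶜ
    disjoint_compl_right h
    (by
      intro v hv
      simp only [Finset.mem_compl, Finset.mem_union, not_or] at hv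
      simp only [Finset.mem_union]
      exact Or.inl (Or.inl (hh v hv.1.1).1))
    (hinj.mono (by
      intro v hv
      simp only [Finset.coe_compl, Set.mem_compl_iff, Finset.mem_coe, Finset.mem_union,
        not_or] at hv
      exact hv.1.1))
  rw [Finset.union_compl] at c3
  have hmem : ∀ v, v ∈ ((W ∪ X.image a) ∪ X.image b)ᶜ → v ∉ W := fun v hv => by
    simp only [Finset.mem_compl, Finset.mem_union, not_or] at hv
    exact hv.1.1
  refine ⟨ρ, by simpa using c3, fun z => ?_⟩
  by_cases hz : z ∈ ((W ∪ X.image a) ∪ X.image b)ᶜ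
  · refine Or.inr (Or.inr (Or.inr (Or.inr (Or.inr ⟨z, hmem z hz, rfl, ?_⟩))))
    obtain ⟨h1, h2⟩ := hh z (hmem z hz)
    rw [(e3 z hz).2, o2' _ h1, o1' _ h1 h2]
  by_cases hzh : ∃ v ∈ ((W ∪ X.image a) ∪ X.image b)ᶜ, h v = z
  · obtain ⟨v, hv, rfl⟩ := hzh
    exact Or.inr (Or.inr (Or.inr (Or.inr (Or.inl ⟨v, hmem v hv, rfl, (e3 v hv).1⟩))))
  push Not at hzh
  rw [Finset.mem_compl, not_not] at hz
  have hρ : ρ z = ρ₂ z := o3 z hz hzh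
  rw [hρ]
  simp only [Finset.mem_union, Finset.mem_image] at hz
  rcases hz with (hz | ⟨x, hx, rfl⟩) | ⟨x, hx, rfl⟩
  · rw [o2' z hz]
    by_cases hzX : z ∈ X
    · exact Or.inr (Or.inl ⟨hzX, (e1' z hzX).1⟩)
    · exact Or.inl ⟨hz, hzX, o1' z hz hzX⟩
  · exact Or.inr (Or.inr (Or.inl ⟨x, hx, rfl, (e2' x hx).1⟩))
  · exact Or.inr (Or.inr (Or.inr (Or.inl ⟨x, hx, rfl, (e2' x hx).2⟩)))

theorem card_filter_and_le_ite {α : Type*} [Fintype α] (p : Prop) (q : α → Prop) (N : ℕ)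
    (h : (Finset.univ.filter q).card ≤ N) :
    (Finset.univ.filter fun a => p ∧ q a).card ≤ if p then N else 0 := by
  by_cases hp : p <;> simp [hp, h]

theorem card_filter_fst_eq_le {V : Type*} [Fintype V] (a : V) :
    (Finset.univ.filter fun p : V × V => p.1 = a).card ≤ Fintype.card V := by
  rw [← Finset.card_univ]
  refine Finset.card_le_card_of_injOn Prod.snd (by simp) ?_
  rintro ⟨p, q⟩ hp ⟨p', q'⟩ hp' h
  simp at hp hp' h
  simp [hp, hp', h]

theorem card_filter_snd_eq_le {V : Type*} [Fintype V] (a : V) :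
    (Finset.univ.filter fun p : V × V => p.2 = a).card ≤ Fintype.card V := by
  rw [← Finset.card_univ]
  refine Finset.card_le_card_of_injOn Prod.fst (by simp) ?_
  rintro ⟨p, q⟩ hp ⟨p', q'⟩ hp' h
  simp at hp hp' h
  simp [hp, hp', h]

/-- Simultaneous choice, for all pairs `(i, x)` with `x ∈ X i`, of the two inner vertices of a path
of length three joining `x` to `s i x`. -/
theorem exists_linking_vertices {V I : Type*} [Fintype V] [Fintype I] (X : I → Finset V)
    (s : I → V → V) (hs : ∀ i, Set.InjOn (s i) (X i)) (P : ℕ) (hP1 : ∀ i, (X i).card ≤ P)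
    (hP2 : ∀ x, (Finset.univ.filter fun i => x ∈ X i).card ≤ P)
    (hP3 : ∀ y, (Finset.univ.filter fun i => ∃ x ∈ X i, s i x = y).card ≤ P)
    (cand : I → V → Finset (V × V))
    (hcand : ∀ i, ∀ x ∈ X i, P * (6 * Fintype.card V + Fintype.card I) < (cand i x).card) :
    ∃ g : I → V → V × V, (∀ i, ∀ x ∈ X i, g i x ∈ cand i x) ∧
      (∀ i, ∀ x ∈ X i, ∀ y ∈ X i, x ≠ y → (g i x).1 ≠ (g i y).1 ∧ (g i x).1 ≠ (g i y).2 ∧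
        (g i x).2 ≠ (g i y).2) ∧
      ∀ i j, i ≠ j → ∀ x ∈ X i, ∀ y ∈ X j, g i x ≠ g j y ∧ (x = y → (g i x).1 ≠ (g j y).1) ∧
        (s i x = s j y → (g i x).2 ≠ (g j y).2) := by
  set n := Fintype.card V
  let T := {p : I × V // p.2 ∈ X p.1}
  have hT1 : ∀ i, (Finset.univ.filter fun τ : T => i = τ.1.1).card ≤ P := fun i => by
    refine le_trans (Finset.card_le_card_of_injOn (fun τ => τ.1.2) ?_ ?_) (hP1 i)
    · rintro ⟨⟨j, x⟩, hx⟩ h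
      simp at h hx ⊢
      subst h; exact hx
    · rintro ⟨⟨j, x⟩, hx⟩ h ⟨⟨j', x'⟩, hx'⟩ h' e
      simp at h h' e
      simp [← h, ← h', e]
  have hT2 : ∀ x, (Finset.univ.filter fun τ : T => x = τ.1.2).card ≤ P := fun x => by
    refine le_trans (Finset.card_le_card_of_injOn (fun τ => τ.1.1) ?_ ?_) (hP2 x)
    · rintro ⟨⟨j, x⟩, hx⟩ h
      simp at h hx ⊢
      subst h; exact hx
    · rintro ⟨⟨j, x⟩, hx⟩ h ⟨⟨j', x'⟩, hx'⟩ h' e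
      simp at h h' e
      simp [← h, ← h', e]
  have hT3 : ∀ y, (Finset.univ.filter fun τ : T => y = s τ.1.1 τ.1.2).card ≤ P := fun y => by
    refine le_trans (Finset.card_le_card_of_injOn (fun τ => τ.1.1) ?_ ?_) (hP3 y)
    · rintro ⟨⟨j, x⟩, hx⟩ h
      simp at h hx ⊢
      exact ⟨x, hx, h.symm⟩
    · rintro ⟨⟨j, x⟩, hx⟩ h ⟨⟨j', x'⟩, hx'⟩ h' e
      simp at h h' e hx hx'
      subst e
      have := hs j hx hx' (h.symm.trans h')
      simp [this]
  have hT : Fintype.card T ≤ P * Fintype.card I := by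
    rw [Fintype.card, Finset.card_eq_sum_card_fiberwise (f := fun τ : T => τ.1.1)
      (t := (Finset.univ : Finset I)) (by simp [Set.MapsTo])]
    refine le_trans (Finset.sum_le_card_nsmul _ _ P fun i _ => ?_) ?_
    · simpa [eq_comm] using hT1 i
    · simp [mul_comm]
  obtain ⟨g, hg, hc⟩ := exists_choice_without_conflicts (T := T) (fun τ => cand τ.1.1 τ.1.2)
    (fun τ ω τ' ω' => ((τ.1.1 = τ'.1.1 ∧ ω.1 = ω'.1) ∨ (τ.1.1 = τ'.1.1 ∧ ω.1 = ω'.2) ∨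
      (τ.1.1 = τ'.1.1 ∧ ω.2 = ω'.1) ∨ (τ.1.1 = τ'.1.1 ∧ ω.2 = ω'.2)) ∨
      (τ.1.2 = τ'.1.2 ∧ ω.1 = ω'.1) ∨ (s τ.1.1 τ.1.2 = s τ'.1.1 τ'.1.2 ∧ ω.2 = ω'.2) ∨ ω = ω')
    (fun τ τ' => 4 * (if τ.1.1 = τ'.1.1 then n else 0) + (if τ.1.2 = τ'.1.2 then n else 0) +
      (if s τ.1.1 τ.1.2 = s τ'.1.1 τ'.1.2 then n else 0) + 1)
    (by
      intro τ ω τ' ω' h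
      simp only [eq_comm (a := τ'.1.1), eq_comm (a := τ'.1.2), eq_comm (a := ω'),
        eq_comm (a := ω'.1),
        eq_comm (a := ω'.2), eq_comm (a := s τ'.1.1 τ'.1.2)]
      tauto)
    (by
      intro τ τ' ω'
      have e1 := card_filter_and_le_ite (τ.1.1 = τ'.1.1) _ n (card_filter_fst_eq_le ω'.1)
      have e2 := card_filter_and_le_ite (τ.1.1 = τ'.1.1) _ n (card_filter_snd_eq_le ω'.1)
      have e3 := card_filter_and_le_ite (τ.1.1 = τ'.1.1) _ n (card_filter_fst_eq_le ω'.2)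
      have e4 := card_filter_and_le_ite (τ.1.1 = τ'.1.1) _ n (card_filter_snd_eq_le ω'.2)
      have e5 := card_filter_and_le_ite (τ.1.2 = τ'.1.2) _ n (card_filter_fst_eq_le ω'.1)
      have e6 := card_filter_and_le_ite (s τ.1.1 τ.1.2 = s τ'.1.1 τ'.1.2) _ n
        (card_filter_snd_eq_le ω'.2)
      have e7 : (Finset.univ.filter fun ω : V × V => ω = ω').card ≤ 1 := by
        simp [Finset.filter_eq']
      refine le_trans (Finset.card_le_card (t :=
        ((((((Finset.univ.filter _ ∪ Finset.univ.filter _) ∪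
        Finset.univ.filter _) ∪ Finset.univ.filter _) ∪ Finset.univ.filter _) ∪
        Finset.univ.filter _) ∪ Finset.univ.filter _)) ?_) (le_trans
        ((Finset.card_union_le _ _).trans (Nat.add_le_add ((Finset.card_union_le _ _).trans
          (Nat.add_le_add ((Finset.card_union_le _ _).trans (Nat.add_le_add
          ((Finset.card_union_le _ _).trans (Nat.add_le_add ((Finset.card_union_le _ _).trans
          (Nat.add_le_add ((Finset.card_union_le _ _).trans (Nat.add_le_add e1 e2)) e3)) e4)) e5))
          e6)) e7)) (by omega))
      intro ω hω
      simp only [Finset.mem_filter, Finset.mem_union, Finset.mem_univ, true_and] at hω ⊢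
      simp only [eq_comm (a := τ'.1.1), eq_comm (a := τ'.1.2), eq_comm (a := ω'),
        eq_comm (a := ω'.1), eq_comm (a := ω'.2), eq_comm (a := s τ'.1.1 τ'.1.2)] at hω
      tauto)
    (by
      rintro ⟨⟨i, x⟩, hx⟩
      refine lt_of_le_of_lt ?_ (hcand i x hx)
      simp only [Finset.sum_add_distrib, ← Finset.mul_sum, ← Finset.sum_filter, Finset.sum_const,
        smul_eq_mul, mul_one, Finset.card_univ]
      have := Nat.mul_le_mul_right n (hT1 i)
      have := Nat.mul_le_mul_right n (hT2 x)
      have := Nat.mul_le_mul_right n (hT3 (s i x))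
      nlinarith)
  refine ⟨fun i x => if hx : x ∈ X i then g ⟨(i, x), hx⟩ else (x, x), ?_, ?_, ?_⟩
  · intro i x hx
    simpa [hx] using hg ⟨(i, x), hx⟩
  · intro i x hx y hy hxy
    have := hc ⟨(i, x), hx⟩ ⟨(i, y), hy⟩ (fun e => hxy (congrArg (fun τ : T => τ.1.2) e))
    simp only [hx, hy, dif_pos]
    simp only [true_and, not_or] at this
    exact ⟨this.1.1, this.1.2.1, this.1.2.2.2⟩
  · intro i j hij x hx y hy
    have := hc ⟨(i, x), hx⟩ ⟨(j, y), hy⟩ (fun e => hij (congrArg (fun τ : T => τ.1.1) e))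
    simp only [hx, hy, dif_pos]
    simp only [not_or, not_and] at this
    exact ⟨this.2.2.2, this.2.1, this.2.2.1⟩

/-- Simultaneous choice, for all pairs `(i, v)` with `v ∈ U i`, of a host vertex. -/
theorem exists_hosts {V I : Type*} [Fintype V] [Fintype I] (U : I → Finset V)
    (s : I → V → V) (hs : ∀ i, Function.Injective (s i)) (Q : ℕ) (hQ1 : ∀ i, (U i).card ≤ Q)
    (hQ2 : ∀ v, (Finset.univ.filter fun i => v ∈ U i).card ≤ Q)
    (cand : I → V → Finset V) (hcand : ∀ i, ∀ v ∈ U i, 3 * Q < (cand i v).card) :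
    ∃ h : I → V → V, (∀ i, ∀ v ∈ U i, h i v ∈ cand i v) ∧ (∀ i, Set.InjOn (h i) (U i)) ∧
      ∀ i j, i ≠ j → ∀ v ∈ U i, v ∈ U j → h i v ≠ h j v ∧ s i (h i v) ≠ s j (h j v) := by
  let T := {p : I × V // p.2 ∈ U p.1}
  have hT1 : ∀ i, (Finset.univ.filter fun τ : T => i = τ.1.1).card ≤ Q := fun i => by
    refine le_trans (Finset.card_le_card_of_injOn (fun τ => τ.1.2) ?_ ?_) (hQ1 i)
    · rintro ⟨⟨j, x⟩, hx⟩ h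
      simp at h hx ⊢
      subst h; exact hx
    · rintro ⟨⟨j, x⟩, hx⟩ h ⟨⟨j', x'⟩, hx'⟩ h' e
      simp at h h' e
      simp [← h, ← h', e]
  have hT2 : ∀ x, (Finset.univ.filter fun τ : T => x = τ.1.2).card ≤ Q := fun x => by
    refine le_trans (Finset.card_le_card_of_injOn (fun τ => τ.1.1) ?_ ?_) (hQ2 x)
    · rintro ⟨⟨j, x⟩, hx⟩ h
      simp at h hx ⊢
      subst h; exact hx
    · rintro ⟨⟨j, x⟩, hx⟩ h ⟨⟨j', x'⟩, hx'⟩ h' e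
      simp at h h' e
      simp [← h, ← h', e]
  obtain ⟨g, hg, hc⟩ := exists_choice_without_conflicts (T := T) (fun τ => cand τ.1.1 τ.1.2)
    (fun τ ω τ' ω' => (τ.1.1 = τ'.1.1 ∧ ω = ω') ∨ (τ.1.2 = τ'.1.2 ∧ ω = ω') ∨
      (τ.1.2 = τ'.1.2 ∧ s τ.1.1 ω = s τ'.1.1 ω'))
    (fun τ τ' => (if τ.1.1 = τ'.1.1 then 1 else 0) + 2 * (if τ.1.2 = τ'.1.2 then 1 else 0))
    (by
      intro τ ω τ' ω' h
      rcases h with ⟨h, h'⟩ | ⟨h, h'⟩ | ⟨h, h'⟩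
      · exact Or.inl ⟨h.symm, h'.symm⟩
      · exact Or.inr (Or.inl ⟨h.symm, h'.symm⟩)
      · exact Or.inr (Or.inr ⟨h.symm, h'.symm⟩))
    (by
      intro τ τ' ω'
      have e0 : (Finset.univ.filter fun ω : V => ω = ω').card ≤ 1 :=
        Finset.card_le_one.2 fun a ha b hb => by
          simp only [Finset.mem_filter] at ha hb; rw [ha.2, hb.2]
      have e0' : (Finset.univ.filter fun ω : V => s τ.1.1 ω = s τ'.1.1 ω').card ≤ 1 :=
        Finset.card_le_one.2 fun a ha b hb => hs τ.1.1 (by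
          simp only [Finset.mem_filter] at ha hb; rw [ha.2, hb.2])
      have e1 := card_filter_and_le_ite (τ.1.1 = τ'.1.1) _ 1 e0
      have e2 := card_filter_and_le_ite (τ.1.2 = τ'.1.2) _ 1 e0
      have e3 := card_filter_and_le_ite (τ.1.2 = τ'.1.2) _ 1 e0'
      refine le_trans (Finset.card_le_card (t := ((Finset.univ.filter _ ∪ Finset.univ.filter _) ∪
        Finset.univ.filter _)) ?_) (le_trans
        ((Finset.card_union_le _ _).trans (Nat.add_le_add
          ((Finset.card_union_le _ _).trans (Nat.add_le_add e1 e2)) e3)) (by omega))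
      intro ω hω
      simp only [Finset.mem_filter, Finset.mem_union, Finset.mem_univ, true_and] at hω ⊢
      simp only [eq_comm (a := τ'.1.1), eq_comm (a := τ'.1.2), eq_comm (a := ω'),
        eq_comm (a := s τ'.1.1 ω')] at hω
      tauto)
    (by
      rintro ⟨⟨i, x⟩, hx⟩
      refine lt_of_le_of_lt ?_ (hcand i x hx)
      simp only [Finset.sum_add_distrib, ← Finset.mul_sum, ← Finset.sum_filter, Finset.sum_const,
        smul_eq_mul, mul_one]
      have := hT1 i
      have := hT2 x
      omega)
  refine ⟨fun i x => if hx : x ∈ U i then g ⟨(i, x), hx⟩ else x, ?_, ?_, ?_⟩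
  · intro i x hx
    simpa [hx] using hg ⟨(i, x), hx⟩
  · intro i x hx y hy hxy
    simp only [Finset.mem_coe] at hx hy
    by_contra hne
    have := hc ⟨(i, x), hx⟩ ⟨(i, y), hy⟩ (fun e => hne (congrArg (fun τ : T => τ.1.2) e))
    simp only [hx, hy, dif_pos] at hxy
    simp [hxy] at this
  · intro i j hij x hx hy
    have := hc ⟨(i, x), hx⟩ ⟨(j, x), hy⟩ (fun e => hij (congrArg (fun τ : T => τ.1.1) e))
    simp only [hx, hy, dif_pos]
    simp only [not_or, not_and] at this
    exact ⟨this.2.1 trivial, this.2.2 trivial⟩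

/-- Edge-disjoint path systems whose paths can be linked up, and into which the uncovered vertices
can be inserted, through reserved edges give edge-disjoint Hamilton cycles. The map `κ`
distributes the edges into the class `0` used by the paths and the reserved classes `1, …, 5`. -/
theorem exists_hamilton_cycles_of_path_systems {V I : Type*} [Fintype V] [Nonempty V] [Fintype I]
    (G : V → V → Prop) (hG : ∀ v, ¬ G v v) (κ : V → V → ℕ) (W : I → Finset V)
    (F : I → V → V → Prop) (r : I → V → ℕ) (hFW : ∀ i u w, F i u w → u ∈ W i ∧ w ∈ W i)
    (hF : ∀ i u w w', F i u w → F i u w' → w = w') (hF' : ∀ i u u' w, F i u w → F i u' w → u = u')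
    (hr : ∀ i u w, F i u w → r i u < r i w) (hFG : ∀ i u w, F i u w → G u w ∧ κ u w = 0)
    (hFd : ∀ i j u w, F i u w → F j u w → i = j) (P Q : ℕ)
    (hP1 : ∀ i, ((W i).filter fun x => ∀ w, ¬ F i x w).card ≤ P)
    (hP2 : ∀ x, (Finset.univ.filter fun i => x ∈ W i ∧ ∀ w, ¬ F i x w).card ≤ P)
    (hP3 : ∀ y, (Finset.univ.filter fun i => y ∈ W i ∧ ∀ u, ¬ F i u y).card ≤ P)
    (hQ1 : ∀ i, (Finset.univ.filter fun v => v ∉ W i).card ≤ Q)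
    (hQ2 : ∀ v, (Finset.univ.filter fun i => v ∉ W i).card ≤ Q)
    (hlink : ∀ i x s, P * (6 * Fintype.card V + Fintype.card I) <
      (Finset.univ.filter fun p : V × V => p.1 ∉ W i ∧ p.2 ∉ W i ∧ (G x p.1 ∧ κ x p.1 = 1) ∧
        (G p.1 p.2 ∧ κ p.1 p.2 = 2) ∧ (G p.2 s ∧ κ p.2 s = 3)).card)
    (hins : ∀ i, ∀ v ∉ W i, 3 * Q < (Finset.univ.filter fun x => ∃ y, F i x y ∧
      (G x v ∧ κ x v = 4) ∧ (G v y ∧ κ v y = 5)).card) :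
    ∃ σ : I → Equiv.Perm V, (∀ i, IsHamCycle G (σ i)) ∧
      ∀ i j, i ≠ j → ∀ v, σ i v ≠ σ j v := by
  choose σ₀ hc hfix hext using fun i => exists_isCycleOn_extending (W i) (F i) (r i)
    (hF i) (hF' i) (hr i)
  let X : I → Finset V := fun i => (W i).filter fun x => ∀ w, ¬ F i x w
  have hXW : ∀ i, X i ⊆ W i := fun i => Finset.filter_subset _ _
  have hX : ∀ i x, x ∈ W i → x ∉ X i → F i x (σ₀ i x) := by
    intro i x hx hxX
    simp only [X, Finset.mem_filter, hx, true_and, not_forall, not_not] at hxX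
    obtain ⟨w, hw⟩ := hxX
    rw [hext i x hx w (hFW i x w hw).2 hw]
    exact hw
  have hFσ : ∀ i x y, F i x y → σ₀ i x = y ∧ x ∉ X i := fun i x y h =>
    ⟨hext i x (hFW i x y h).1 y (hFW i x y h).2 h, fun hx => (Finset.mem_filter.1 hx).2 y h⟩
  have hXF : ∀ i x, x ∈ X i → ∀ u, ¬ F i u (σ₀ i x) := by
    intro i x hx u hu
    have h1 := (hFσ i u _ hu).1
    exact (hFσ i u _ hu).2 ((σ₀ i).injective h1 ▸ hx)
  obtain ⟨g, hg1, hg2, hg3⟩ := exists_linking_vertices X (fun i => σ₀ i)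
    (fun i => (σ₀ i).injective.injOn) P hP1
    (fun x => by simpa only [X, Finset.mem_filter] using hP2 x)
    (fun y => by
      refine le_trans (Finset.card_le_card fun i hi => ?_) (hP3 y)
      simp only [Finset.mem_filter, Finset.mem_univ, true_and] at hi ⊢
      obtain ⟨x, hx, rfl⟩ := hi
      exact ⟨(hc i).1.mapsTo (hXW i hx), hXF i x hx⟩)
    (fun i x => Finset.univ.filter fun p : V × V => p.1 ∉ W i ∧ p.2 ∉ W i ∧
      (G x p.1 ∧ κ x p.1 = 1) ∧ (G p.1 p.2 ∧ κ p.1 p.2 = 2) ∧ (G p.2 (σ₀ i x) ∧ κ p.2 (σ₀ i x) = 3))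
    (fun i x hx => hlink i x _)
  simp only [Finset.mem_filter, Finset.mem_univ, true_and] at hg1
  obtain ⟨h, hh1, hh2, hh3⟩ := exists_hosts (fun i => Finset.univ.filter fun v => v ∉ W i)
    (fun i => σ₀ i) (fun i => (σ₀ i).injective) Q hQ1
    (fun v => by simpa using hQ2 v)
    (fun i v => Finset.univ.filter fun x => ∃ y, F i x y ∧ (G x v ∧ κ x v = 4) ∧
      (G v y ∧ κ v y = 5))
    (fun i v hv => hins i v (by simpa using hv))
  simp only [Finset.mem_filter, Finset.mem_univ, true_and, Finset.coe_filter] at hh1 hh2 hh3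
  have hh1' : ∀ i, ∀ v ∉ W i, h i v ∈ W i ∧ h i v ∉ X i ∧ (G (h i v) v ∧ κ (h i v) v = 4) ∧
      (G v (σ₀ i (h i v)) ∧ κ v (σ₀ i (h i v)) = 5) := by
    intro i v hv
    obtain ⟨y, hy, h4, h5⟩ := hh1 i v hv
    rw [(hFσ i _ y hy).1]
    exact ⟨(hFW i _ y hy).1, (hFσ i _ y hy).2, h4, h5⟩
  choose ρ hρc hρ using fun i => exists_spanning_cycle (hc i) (hfix i) (X i) (hXW i)
    (fun x => (g i x).1) (fun x => (g i x).2)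
    (fun x hx y hy hxy => by_contra fun hne => (hg2 i x hx y hy hne).1 hxy)
    (fun x hx y hy hxy => by_contra fun hne => (hg2 i x hx y hy hne).2.2 hxy)
    (fun x hx => (hg1 i x hx).1) (fun x hx => (hg1 i x hx).2.1)
    (fun x hx y hy hxy => by
      by_cases hne : x = y
      · subst hne
        have := (hg1 i x hx).2.2.2.1.1
        rw [hxy] at this
        exact hG _ this
      · exact (hg2 i x hx y hy hne).2.1 hxy)
    (h i) (fun v hv => ⟨(hh1' i v hv).1, (hh1' i v hv).2.1⟩) (hh2 i)
  have key : ∀ i z, G z (ρ i z) ∧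
      ((κ z (ρ i z) = 0 ∧ F i z (ρ i z)) ∨ (κ z (ρ i z) = 1 ∧ z ∈ X i ∧ ρ i z = (g i z).1) ∨
      (κ z (ρ i z) = 2 ∧ ∃ x ∈ X i, (z, ρ i z) = g i x) ∨
      (κ z (ρ i z) = 3 ∧ ∃ x ∈ X i, z = (g i x).2 ∧ ρ i z = σ₀ i x) ∨
      (κ z (ρ i z) = 4 ∧ ∃ v ∉ W i, z = h i v ∧ ρ i z = v) ∨
      (κ z (ρ i z) = 5 ∧ z ∉ W i ∧ ρ i z = σ₀ i (h i z))) := by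
    intro i z
    rcases hρ i z with ⟨hz, hzX, e⟩ | ⟨hz, e⟩ | ⟨x, hx, e1, e2⟩ | ⟨x, hx, e1, e2⟩ |
      ⟨v, hv, e1, e2⟩ |
      ⟨v, hv, e1, e2⟩
    · rw [e]
      have hF1 := hX i z hz hzX
      have := hFG i _ _ hF1
      exact ⟨this.1, Or.inl ⟨this.2, hF1⟩⟩
    · have := (hg1 i z hz).2.2.1
      rw [e]
      exact ⟨this.1, Or.inr (Or.inl ⟨this.2, hz, rfl⟩)⟩
    · have := (hg1 i x hx).2.2.2.1
      rw [e2, e1]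
      exact ⟨this.1, Or.inr (Or.inr (Or.inl ⟨this.2, x, hx, rfl⟩))⟩
    · have := (hg1 i x hx).2.2.2.2
      rw [e2, e1]
      exact ⟨this.1, Or.inr (Or.inr (Or.inr (Or.inl ⟨this.2, x, hx, rfl, rfl⟩)))⟩
    · have := (hh1' i v hv).2.2.1
      rw [e2, e1]
      exact ⟨this.1, Or.inr (Or.inr (Or.inr (Or.inr (Or.inl ⟨this.2, v, hv, rfl, rfl⟩))))⟩
    · have := (hh1' i v hv).2.2.2
      rw [e2, e1]
      exact ⟨this.1, Or.inr (Or.inr (Or.inr (Or.inr (Or.inr ⟨this.2, hv, rfl⟩))))⟩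
  have hne : ∀ i z, ρ i z ≠ z := fun i z hz => hG z (by simpa [hz] using (key i z).1)
  refine ⟨ρ, fun i => ⟨?_, hne i, fun v => (key i v).1⟩, ?_⟩
  · obtain ⟨v⟩ := ‹Nonempty V›
    exact ⟨v, hne i v, fun w _ => (hρc i).2 trivial trivial⟩
  · intro i j hij z hz
    have k1 := (key i z).2
    have k2 := (key j z).2
    rw [← hz] at k2
    rcases k1 with ⟨c1, k1⟩ | ⟨c1, k1⟩ | ⟨c1, k1⟩ | ⟨c1, k1⟩ | ⟨c1, k1⟩ | ⟨c1, k1⟩ <;>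
    rcases k2 with ⟨c2, k2⟩ | ⟨c2, k2⟩ | ⟨c2, k2⟩ | ⟨c2, k2⟩ | ⟨c2, k2⟩ | ⟨c2, k2⟩ <;>
    first
    | (exfalso; omega)
    | skip
    · exact hij (hFd i j _ _ k1 k2)
    · exact (hg3 i j hij z k1.1 z k2.1).2.1 rfl (k1.2.symm.trans k2.2)
    · obtain ⟨x, hx, e⟩ := k1
      obtain ⟨y, hy, e'⟩ := k2
      exact (hg3 i j hij x hx y hy).1 (e.symm.trans e')
    · obtain ⟨x, hx, e1, e2⟩ := k1
      obtain ⟨y, hy, e1', e2'⟩ := k2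
      exact (hg3 i j hij x hx y hy).2.2 (e2.symm.trans e2') (e1.symm.trans e1')
    · obtain ⟨v, hv, e1, e2⟩ := k1
      obtain ⟨w, hw, e1', e2'⟩ := k2
      have : v = w := e2.symm.trans e2'
      subst this
      exact (hh3 i j hij v hv hw).1 (e1.symm.trans e1')
    · exact (hh3 i j hij z k1.1 k2.1).2 (k1.2.symm.trans k2.2)

theorem exists_labelling_sum_close {V L J : Type*} [Fintype V] [Fintype L] [Nonempty L] [Fintype J]
    (w : J → V → ℝ) (h0 : ∀ j v, 0 ≤ w j v) (h1 : ∀ j v, w j v ≤ 1) {t : ℝ} (ht : 0 ≤ t)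
    (hJ : 2 * (Fintype.card J : ℝ) * Fintype.card L * Real.exp (-2 * t ^ 2 / Fintype.card V) < 1) :
    ∃ f : V → L, ∀ j l, |∑ v ∈ Finset.univ.filter (fun v => f v = l), w j v -
      (∑ v, w j v) / Fintype.card L| ≤ t := by
  have hL : (0 : ℝ) < Fintype.card L := by exact_mod_cast Fintype.card_pos
  obtain ⟨f, hf⟩ := exists_forall_sum_le_average_add (J := J × L × Bool) (L := L) (I := V)
    (fun j v l => if j.2.2 then (if l = j.2.1 then w j.1 v else 0)
      else 1 - (if l = j.2.1 then w j.1 v else 0))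
    (by rintro ⟨j, l, b⟩ v l'; dsimp only; have := h0 j v; have := h1 j v; split_ifs <;> linarith)
    (by rintro ⟨j, l, b⟩ v l'; dsimp only; have := h0 j v; have := h1 j v; split_ifs <;> linarith)
    ht (by
      refine lt_of_eq_of_lt ?_ hJ
      simp only [Fintype.card_prod, Fintype.card_bool]
      push_cast
      ring)
  refine ⟨f, fun j l => ?_⟩
  have e1 := hf (j, l, true)
  have e2 := hf (j, l, false)
  simp only [if_true, Bool.false_eq_true, if_false, Finset.sum_sub_distrib, Finset.sum_ite_eq',
    Finset.mem_univ, Finset.sum_const, Finset.card_univ, nsmul_eq_mul, mul_one,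
    ← Finset.sum_filter, ← Finset.sum_div, sub_div, div_self hL.ne'] at e1 e2
  rw [abs_le]
  constructor <;> linarith

theorem two_mul_sum_card_filter {V : Type*} {G : V → V → Prop} (hG : ∀ v, ¬ G v v)
    (hT : ∀ u v : V, u ≠ v → (G u v ↔ ¬ G v u))
    (S : Finset V) : 2 * ∑ x ∈ S, ((S.filter (G x)).card : ℝ) = S.card * (S.card - 1) := by
  have h1 : ∑ x ∈ S, ((S.filter (G x)).card : ℝ) = ∑ x ∈ S, ∑ y ∈ S,
      if G x y then (1 : ℝ) else 0 := by
    simp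
  have h2 : ∑ x ∈ S, ((S.filter (G x)).card : ℝ) = ∑ x ∈ S, ∑ y ∈ S,
      if G y x then (1 : ℝ) else 0 := by
    rw [h1, Finset.sum_comm]
  rw [two_mul]
  nth_rewrite 1 [h1]
  rw [h2, ← Finset.sum_add_distrib]
  have : ∀ x ∈ S, (∑ y ∈ S, if G x y then (1 : ℝ) else 0) +
    (∑ y ∈ S, if G y x then (1 : ℝ) else 0) =
      S.card - 1 := by
    intro x hx
    rw [← Finset.sum_add_distrib]
    have : ∀ y ∈ S, ((if G x y then (1 : ℝ) else 0) + if G y x then (1 : ℝ) else 0) =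
        1 - if y = x then 1 else 0 := by
      intro y _
      by_cases hxy : y = x
      · subst hxy; simp [hG]
      · have := hT y x hxy
        by_cases h : G x y <;> simp_all
    rw [Finset.sum_congr rfl this]
    simp [hx]
  rw [Finset.sum_congr rfl this, Finset.sum_const, nsmul_eq_mul]

section Tournament

variable {V : Type*} [Fintype V] {G : V → V → Prop}

theorem outDeg_add_inDeg (hG : ∀ v, ¬ G v v) (hT : ∀ u v : V, u ≠ v → (G u v ↔ ¬ G v u)) (v : V) :
    outDeg G v + inDeg G v + 1 = Fintype.card V := by
  have h : (Finset.univ.filter fun u => G v u) ∪ (Finset.univ.filter fun u => G u v) =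
      Finset.univ.erase v := by
    ext u
    by_cases huv : v = u
    · subst huv; simp [hG]
    · simp only [Finset.mem_union, Finset.mem_filter, Finset.mem_univ, true_and, Finset.mem_erase,
        hT v u huv, and_true]
      simp [Ne.symm huv]
      tauto
  have hd : Disjoint (Finset.univ.filter fun u => G v u) (Finset.univ.filter fun u => G u v) := by
    rw [Finset.disjoint_filter]
    intro u _ h1 h2
    by_cases huv : v = u
    · subst huv; exact hG _ h1
    · exact (hT v u huv).1 h1 h2
  have := Finset.card_union_of_disjoint hd
  rw [h, Finset.card_erase_of_mem (Finset.mem_univ v), Finset.card_univ] at this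
  have hpos : 0 < Fintype.card V := Fintype.card_pos_iff.2 ⟨v⟩
  unfold outDeg inDeg
  omega

theorem sq_card_le_sum_card_filter (hG : ∀ v, ¬ G v v)
    (hT : ∀ u v : V, u ≠ v → (G u v ↔ ¬ G v u)) {d : ℕ} (hd : ∀ v, outDeg G v = d)
    (hn : Fintype.card V = 2 * d + 1) (hd7 : 7 ≤ d) {A B : Finset V} (hA : A.card = d)
    (hB : B.card = d) :
    (Fintype.card V : ℝ) ^ 2 / 150 ≤ ∑ x ∈ A, ((B.filter (G x)).card : ℝ) := by
  set e := ∑ x ∈ A, ((B.filter (G x)).card : ℝ) with he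
  set x := ((A ∩ B).card : ℝ) with hx
  have h1 : x * (x - 1) / 2 ≤ e := by
    have := two_mul_sum_card_filter hG hT (A ∩ B)
    have h2 : ∑ x ∈ A ∩ B, (((A ∩ B).filter (G x)).card : ℝ) ≤ e := by
      refine (Finset.sum_le_sum_of_subset_of_nonneg Finset.inter_subset_left
        fun _ _ _ => by positivity).trans (Finset.sum_le_sum fun y _ => ?_)
      exact_mod_cast Finset.card_le_card (Finset.filter_subset_filter _ Finset.inter_subset_right)
    rw [← hx] at this
    linarith
  have hc : ((A ∪ B)ᶜ.card : ℝ) = x + 1 := by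
    have h2 := Finset.card_union_add_card_inter A B
    have h3 := Finset.card_add_card_compl (A ∪ B)
    rw [hx]
    have : (A ∪ B)ᶜ.card = (A ∩ B).card + 1 := by omega
    exact_mod_cast this
  have h2 : (d : ℝ) * d - d * (d - 1) / 2 - d * (x + 1) ≤ e := by
    have hA2 := two_mul_sum_card_filter hG hT A
    have : ∑ y ∈ A, (d : ℝ) ≤ ∑ y ∈ A, (((B.filter (G y)).card : ℝ) + ((A.filter (G y)).card : ℝ) +
        (x + 1)) := by
      refine Finset.sum_le_sum fun y _ => ?_
      rw [← hc, ← hd y, outDeg]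
      norm_cast
      refine le_trans (Finset.card_le_card (t := (B.filter (G y) ∪ A.filter (G y)) ∪ (A ∪ B)ᶜ) ?_)
        ((Finset.card_union_le _ _).trans (Nat.add_le_add_right (Finset.card_union_le _ _) _))
      intro z hz
      simp only [Finset.mem_filter, Finset.mem_univ, true_and, Finset.mem_union,
        Finset.mem_compl] at hz ⊢
      tauto
    simp only [Finset.sum_add_distrib, Finset.sum_const, nsmul_eq_mul, hA] at this
    rw [hA] at hA2
    linarith
  have hd7' : (7 : ℝ) ≤ d := by exact_mod_cast hd7
  rw [hn]
  push_cast
  by_cases hxd : x ≤ d / 4 + 1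
  · nlinarith
  · push Not at hxd
    nlinarith

/-- The out-neighbourhood (`b = true`) or in-neighbourhood (`b = false`) of a vertex. -/
noncomputable def nbhd (G : V → V → Prop) (p : V × Bool) : Finset V :=
  Finset.univ.filter fun u => if p.2 then G p.1 u else G u p.1

theorem card_filter_pairs_eq_sum {V : Type*} [Fintype V] {G : V → V → Prop} (A B : Finset V)
    (R S : V → Prop) :
    ((Finset.univ.filter fun p : V × V => p.1 ∈ A ∧ p.2 ∈ B ∧ G p.1 p.2 ∧ R p.1 ∧ S p.2).card : ℝ) =
      ∑ x ∈ A.filter R, (((B.filter (G x)).filter S).card : ℝ) := by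
  norm_cast
  rw [Finset.card_eq_sum_card_fiberwise (f := Prod.fst) (t := A.filter R)
    (fun p hp => by
      simp only [Finset.coe_filter, Finset.mem_univ, true_and, Set.mem_ofPred_eq] at hp ⊢
      exact ⟨hp.1, hp.2.2.2.1⟩)]
  refine Finset.sum_congr rfl fun x hx => ?_
  rw [Finset.mem_filter] at hx
  refine Finset.card_bij (fun p _ => p.2) ?_ ?_ ?_
  · rintro ⟨p, q⟩ h
    simp only [Finset.mem_filter, Finset.mem_univ, true_and] at h ⊢
    obtain ⟨h, rfl⟩ := h
    exact ⟨⟨h.2.1, h.2.2.1⟩, h.2.2.2.2⟩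
  · rintro ⟨p, q⟩ h ⟨p', q'⟩ h' e
    simp only [Finset.mem_filter, Finset.mem_univ, true_and] at h h'
    simp only at e
    rw [h.2, h'.2, e]
  · intro y hy
    simp only [Finset.mem_filter] at hy
    exact ⟨(x, y), by simp [hx, hy], rfl⟩

/-- A labelling of the vertices of a regular tournament which splits all neighbourhoods, and the
edges between any two of them, evenly. -/
theorem exists_regular_labelling {L : Type*} [Fintype L] [Nonempty L] (hG : ∀ v, ¬ G v v)
    (hT : ∀ u v : V, u ≠ v → (G u v ↔ ¬ G v u)) {d : ℕ} (hd : ∀ v, outDeg G v = d)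
    (hd' : ∀ v, inDeg G v = d) (hn : Fintype.card V = 2 * d + 1) (hd7 : 7 ≤ d) {t : ℝ} (ht : 0 ≤ t)
    (hexp : 18 * (Fintype.card V : ℝ) ^ 2 * Fintype.card L *
      Real.exp (-2 * t ^ 2 / Fintype.card V) < 1) :
    ∃ ℓ : V → L,
      (∀ l, |((Finset.univ.filter fun v => ℓ v = l).card : ℝ) -
        Fintype.card V / Fintype.card L| ≤ t) ∧
      (∀ p l, |(((nbhd G p).filter fun v => ℓ v = l).card : ℝ) - d / Fintype.card L| ≤ t) ∧
      ∀ p q l m, (Fintype.card V : ℝ) ^ 2 / (150 * Fintype.card L ^ 2) - 2 * t * Fintype.card V ≤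
        (Finset.univ.filter fun z : V × V => z.1 ∈ nbhd G p ∧ z.2 ∈ nbhd G q ∧ G z.1 z.2 ∧
          ℓ z.1 = l ∧ ℓ z.2 = m).card := by
  set n := Fintype.card V with hndef
  set K := Fintype.card L
  have hK : (0 : ℝ) < K := by exact_mod_cast Fintype.card_pos
  have hK1 : (1 : ℝ) ≤ K := by exact_mod_cast (Fintype.card_pos : 0 < Fintype.card L)
  have hn15 : 15 ≤ n := by omega
  have hn0 : (15 : ℝ) ≤ n := by exact_mod_cast hn15
  have hN : ∀ p, (nbhd G p).card = d := by
    rintro ⟨v, b⟩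
    cases b
    · simpa [nbhd, inDeg] using hd' v
    · simpa [nbhd, outDeg] using hd v
  let w : (Unit ⊕ (V × Bool)) ⊕ ((V × (V × Bool)) ⊕ ((V × Bool) × (V × Bool))) → V → ℝ := fun j v =>
    match j with
    | Sum.inl (Sum.inl _) => 1
    | Sum.inl (Sum.inr p) => if v ∈ nbhd G p then 1 else 0
    | Sum.inr (Sum.inl (x, p)) => if v ∈ (nbhd G p).filter (G x) then 1 else 0
    | Sum.inr (Sum.inr (p, q)) => if v ∈ nbhd G p then (((nbhd G q).filter (G v)).card : ℝ) / n
        else 0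
  obtain ⟨ℓ, hℓ⟩ := exists_labelling_sum_close (L := L) w
    (by
      rintro ((_ | _) | (_ | _)) v <;> simp only [w] <;> (try split_ifs) <;> positivity)
    (by
      rintro ((_ | _) | (_ | _)) v <;> simp only [w] <;> (try split_ifs) <;> try norm_num
      rw [div_le_one (by linarith)]
      exact_mod_cast Finset.card_le_univ _)
    ht (by
      refine lt_of_le_of_lt (mul_le_mul_of_nonneg_right (mul_le_mul_of_nonneg_right ?_
        (by positivity))
        (Real.exp_pos _).le) hexp
      simp only [Fintype.card_sum, Fintype.card_prod, Fintype.card_bool, Fintype.card_unit]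
      push_cast
      change 2 * (1 + (n : ℝ) * 2 + ((n : ℝ) * (n * 2) + n * 2 * (n * 2))) ≤ 18 * (n : ℝ) ^ 2
      nlinarith)
  refine ⟨ℓ, fun l => ?_, fun p l => ?_, fun p q l m => ?_⟩
  · simpa [w] using hℓ (Sum.inl (Sum.inl ())) l
  · have := hℓ (Sum.inl (Sum.inr p)) l
    simp only [w, Finset.sum_boole, Finset.filter_filter, Finset.filter_univ_mem, hN] at this
    have e : (Finset.univ.filter fun v => ℓ v = l ∧ v ∈ nbhd G p) =
        (nbhd G p).filter fun v => ℓ v = l := by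
      ext v; simp [and_comm]
    rwa [e] at this
  · rw [card_filter_pairs_eq_sum (nbhd G p) (nbhd G q) (fun v => ℓ v = l) (fun v => ℓ v = m)]
    have h1 : ∀ x, ((((nbhd G q).filter (G x)).card : ℝ)) / K - t ≤
        (((nbhd G q).filter (G x)).filter fun v => ℓ v = m).card := by
      intro x
      have := (abs_le.1 (hℓ (Sum.inr (Sum.inl (x, q))) m)).1
      simp only [w, Finset.sum_boole, Finset.filter_filter, Finset.filter_univ_mem] at this
      have e : (Finset.univ.filter fun v => ℓ v = m ∧ v ∈ (nbhd G q).filter (G x)) =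
          ((nbhd G q).filter (G x)).filter fun v => ℓ v = m := by
        ext v; simp [and_comm]
      rw [e] at this
      linarith
    have h2 := (abs_le.1 (hℓ (Sum.inr (Sum.inr (p, q))) l)).1
    have h3 := sq_card_le_sum_card_filter hG hT hd hn hd7 (hN p) (hN q)
    simp only [w, ← Finset.sum_filter, Finset.filter_filter, Finset.filter_univ_mem] at h2
    have e : (Finset.univ.filter fun v => ℓ v = l ∧ v ∈ nbhd G p) =
        (nbhd G p).filter fun v => ℓ v = l := by
      ext v; simp [and_comm]
    rw [e, ← Finset.sum_div, ← Finset.sum_div] at h2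
    have h4 : ∑ x ∈ (nbhd G p).filter (fun v => ℓ v = l),
        (((((nbhd G q).filter (G x)).card : ℝ)) / K - t) ≤ _ :=
      Finset.sum_le_sum fun x _ => h1 x
    refine le_trans ?_ h4
    rw [Finset.sum_sub_distrib, ← Finset.sum_div, Finset.sum_const, nsmul_eq_mul]
    set Y := ∑ x ∈ (nbhd G p).filter (fun v => ℓ v = l), (((nbhd G q).filter (G x)).card : ℝ)
    set Z := ∑ x ∈ nbhd G p, (((nbhd G q).filter (G x)).card : ℝ)
    have h5 : (((nbhd G p).filter fun v => ℓ v = l).card : ℝ) ≤ n := by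
      exact_mod_cast Finset.card_le_univ _
    have h6 : Z / K - t * n ≤ Y := by
      have : Z / n / K - t ≤ Y / n := by linarith
      have h7 := mul_le_mul_of_nonneg_right this (by linarith : (0 : ℝ) ≤ n)
      have e1 : (Z / n / K - t) * n = Z / K - t * n := by field_simp
      have e2 : Y / n * n = Y := by field_simp
      linarith
    have h7 : Z / K ^ 2 - t * n ≤ Y / K := by
      have h8 : (Z / K - t * n) / K ≤ Y / K := div_le_div_of_nonneg_right h6 hK.le
      have e1 : (Z / K - t * n) / K = Z / K ^ 2 - t * n / K := by field_simp
      have h9 : t * n / K ≤ t * n := div_le_self (by positivity) hK1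
      linarith
    have h8 : (n : ℝ) ^ 2 / (150 * K ^ 2) ≤ Z / K ^ 2 := by
      rw [← div_div]
      exact div_le_div_of_nonneg_right h3 (by positivity)
    have h9 := mul_le_mul_of_nonneg_right h5 ht
    linarith

end Tournament

theorem sum_card_filter_fiber {V X : Type*} [Fintype V] [Fintype X] (cl : V → X)
    (p : V → X → Prop) :
    ∑ x, ((Finset.univ.filter fun v => cl v = x ∧ p v x).card : ℝ) =
      (Finset.univ.filter fun v => p v (cl v)).card := by
  norm_cast
  rw [Finset.card_eq_sum_card_fiberwise (f := cl) (t := Finset.univ) (by simp [Set.MapsTo])]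
  refine Finset.sum_congr rfl fun x _ => ?_
  congr 1
  ext v
  simp only [Finset.mem_filter, Finset.mem_univ, true_and]
  constructor
  · rintro ⟨rfl, h⟩; exact ⟨h, rfl⟩
  · rintro ⟨h, rfl⟩; exact ⟨rfl, h⟩

theorem sum_sum_card_filter_fiber {V X C : Type*} [Fintype V] [Fintype X] [Fintype C] (cl : V → X)
    (p : V → C → Prop) :
    ∑ x, ∑ l, ((Finset.univ.filter fun v => cl v = x ∧ p v l).card : ℝ) =
      ∑ v, ((Finset.univ.filter fun l => p v l).card : ℝ) := by
  rw [Finset.sum_comm]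
  have : ∀ l, ∑ x, ((Finset.univ.filter fun v => cl v = x ∧ p v l).card : ℝ) =
      ∑ v, if p v l then (1 : ℝ) else 0 := by
    intro l
    rw [sum_card_filter_fiber cl fun v _ => p v l]
    simp
  rw [Finset.sum_congr rfl fun l _ => this l, Finset.sum_comm]
  simp

/-- Random shifts of the colours, one for each cluster, make the relation `A` sparse in every
colour and the relations `B j` dense in the prescribed colours. -/
theorem exists_balanced_shifts {V C X J : Type*} [Fintype V] [Fintype C] [AddCommGroup C]
    [Fintype X] [Fintype J] (cl : V → X) {m b γ D : ℝ} (hb : 0 < b) (hγ : 0 ≤ γ)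
    (hclb : ∀ x, ((Finset.univ.filter fun v => cl v = x).card : ℝ) ≤ b)
    (A : V → C → Prop) (B : J → V → C → Prop) (cj : J → C)
    (hA : ∀ v, ((Finset.univ.filter fun c => A v c).card : ℝ) ≤ D)
    (hB : ∀ j, m ≤ ∑ v, ((Finset.univ.filter fun c => B j v c).card : ℝ))
    (hexp : ((Fintype.card C : ℝ) + Fintype.card J) * Real.exp (-2 * γ ^ 2 * Fintype.card X) < 1) :
    ∃ τ : X → C,
      (∀ c, ((Finset.univ.filter fun v => A v (c + τ (cl v))).card : ℝ) ≤
        Fintype.card V * D / Fintype.card C + γ * Fintype.card X * b) ∧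
      ∀ j, m / Fintype.card C - γ * Fintype.card X * b ≤
        (Finset.univ.filter fun v => B j v (cj j + τ (cl v))).card := by
  have hC : (0 : ℝ) < Fintype.card C := by exact_mod_cast Fintype.card_pos
  have hcard : ∀ (p : V → Prop) (x : X),
      ((Finset.univ.filter fun v => cl v = x ∧ p v).card : ℝ) / b ≤ 1 := by
    intro p x
    rw [div_le_one hb]
    refine le_trans ?_ (hclb x)
    exact_mod_cast Finset.card_le_card fun v hv => by
      simp only [Finset.mem_filter, Finset.mem_univ, true_and] at hv ⊢
      exact hv.1
  have hshift : ∀ (p : C → Prop) (c : C), ((Finset.univ.filter fun l => p (c + l)).card : ℝ) =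
      (Finset.univ.filter p).card := by
    intro p c
    norm_cast
    refine Finset.card_bij (fun l _ => c + l) (fun l hl => by simpa using hl)
      (fun l _ l' _ h => add_right_injective _ h) fun l hl => ⟨l - c, by simpa using hl, by simp⟩
  obtain ⟨τ, hτ⟩ := exists_forall_sum_le_average_add (I := X) (L := C) (J := C ⊕ J)
    (fun j x l => match j with
      | Sum.inl c => ((Finset.univ.filter fun v => cl v = x ∧ A v (c + l)).card : ℝ) / b
      | Sum.inr j => 1 - ((Finset.univ.filter fun v => cl v = x ∧ B j v (cj j + l)).card : ℝ) / b)
    (by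
      rintro (c | j) x l
      · positivity
      · exact sub_nonneg.2 (hcard _ x))
    (by
      rintro (c | j) x l
      · exact hcard _ x
      · have : 0 ≤ ((Finset.univ.filter fun v => cl v = x ∧ B j v (cj j + l)).card : ℝ) / b := by
          positivity
        dsimp only
        linarith)
    (t := γ * Fintype.card X) (by positivity)
    (by
      refine lt_of_eq_of_lt ?_ hexp
      rw [Fintype.card_sum]
      push_cast
      congr 2
      by_cases h : (Fintype.card X : ℝ) = 0
      · simp [h]
      · field_simp)
  refine ⟨τ, fun c => ?_, fun j => ?_⟩
  · have h := hτ (Sum.inl c)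
    simp only [← Finset.sum_div] at h
    rw [sum_card_filter_fiber cl fun v x => A v (c + τ x),
      sum_sum_card_filter_fiber cl fun v l => A v (c + l)] at h
    simp only [fun v => hshift (A v) c] at h
    have h1 : ∑ v, ((Finset.univ.filter fun l => A v l).card : ℝ) ≤ Fintype.card V * D :=
      (Finset.sum_le_card_nsmul _ _ (D : ℝ) fun v _ => hA v).trans (by simp)
    refine ((div_le_iff₀ hb).1 h).trans ?_
    rw [add_mul]
    refine add_le_add_left ?_ _
    rw [div_div, mul_comm b, ← div_div, div_mul_cancel₀ _ hb.ne']
    exact div_le_div_of_nonneg_right h1 hC.le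
  · have h := hτ (Sum.inr j)
    simp only [Finset.sum_sub_distrib, ← Finset.sum_div] at h
    rw [sum_card_filter_fiber cl fun v x => B j v (cj j + τ x)] at h
    simp only [Finset.sum_const, Finset.card_univ, nsmul_eq_mul, mul_one, sub_div,
      mul_div_cancel_right₀ _ hC.ne'] at h
    rw [sum_sum_card_filter_fiber cl fun v l => B j v (cj j + l)] at h
    simp only [fun v => hshift (B j v) (cj j)] at h
    have h1 := hB j
    set Y := ((Finset.univ.filter fun v => B j v (cj j + τ (cl v))).card : ℝ)
    set Z := ∑ v, ((Finset.univ.filter fun l => B j v l).card : ℝ)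
    have h2 : Z / b / Fintype.card C - γ * Fintype.card X ≤ Y / b := by linarith
    rw [le_div_iff₀ hb, sub_mul, div_div, mul_comm b, ← div_div, div_mul_cancel₀ _ hb.ne'] at h2
    have h3 := div_le_div_of_nonneg_right h1 hC.le
    linarith

theorem card_missing_colors_le {V C : Type*} [Fintype V] [Fintype C] (S : Finset V) (f : V → C)
    (hf : ∀ w ∈ S, ∀ w' ∈ S, f w = f w' → w = w') {D : ℕ} (hS : Fintype.card C ≤ S.card + D) :
    (Finset.univ.filter fun c => c ∉ S.image f).card ≤ D := by
  have h1 : (S.image f).card = S.card := Finset.card_image_of_injOn hf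
  have h2 := Finset.card_compl (S.image f)
  have h3 : (Finset.univ.filter fun c => c ∉ S.image f) = (S.image f)ᶜ := by ext; simp
  rw [h3]
  omega

/-- An almost regular relation has a proper edge colouring in which every colour is missing at few
vertices, and every colour is represented in the given edge sets `E j`. -/
theorem exists_balanced_edge_coloring {V C X J : Type*} [Fintype V] [Fintype C] [AddCommGroup C]
    [Fintype X] [Fintype J] (R : V → V → Prop) (cl : V → X)
    (hcl : ∀ u u' w, R u w → R u' w → cl u = cl u') (D : ℕ)
    (ho : ∀ u, (Finset.univ.filter fun w => R u w).card ≤ Fintype.card C)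
    (hi : ∀ w, (Finset.univ.filter fun u => R u w).card ≤ Fintype.card C)
    (ho' : ∀ u, Fintype.card C ≤ (Finset.univ.filter fun w => R u w).card + D)
    (hi' : ∀ w, Fintype.card C ≤ (Finset.univ.filter fun u => R u w).card + D)
    {m b γ : ℝ} (hb : 0 < b) (hγ : 0 ≤ γ)
    (hclb : ∀ x, ((Finset.univ.filter fun v => cl v = x).card : ℝ) ≤ b)
    (E : J → V → V → Prop) (cj : J → C) (hE : ∀ j u w, E j u w → R u w)
    (hm : ∀ j, m ≤ (Finset.univ.filter fun p : V × V => E j p.1 p.2).card)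
    (hexp : ((Fintype.card C : ℝ) + Fintype.card J) * Real.exp (-2 * γ ^ 2 * Fintype.card X) < 1) :
    ∃ F : C → V → V → Prop,
      (∀ c u w, F c u w → R u w) ∧
      (∀ c u w w', F c u w → F c u w' → w = w') ∧
      (∀ c u u' w, F c u w → F c u' w → u = u') ∧
      (∀ c c' u w, F c u w → F c' u w → c = c') ∧
      (∀ u, (Finset.univ.filter fun c => ∀ w, ¬ F c u w).card ≤ D) ∧
      (∀ w, (Finset.univ.filter fun c => ∀ u, ¬ F c u w).card ≤ D) ∧
      (∀ c, ((Finset.univ.filter fun u => ∀ w, ¬ F c u w).card : ℝ) ≤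
        Fintype.card V * D / Fintype.card C + γ * Fintype.card X * b) ∧
      ∀ j, m / Fintype.card C - γ * Fintype.card X * b ≤
        (Finset.univ.filter fun u => ∃ w, E j u w ∧ F (cj j) u w).card := by
  obtain ⟨col, hc1, hc2⟩ := exists_proper_edge_coloring (C := C) R ho hi
  have hmiss1 : ∀ u, (Finset.univ.filter fun c =>
      c ∉ (Finset.univ.filter fun w => R u w).image (col u)).card ≤ D := fun u =>
    card_missing_colors_le _ _ (fun w hw w' hw' h => by
      simp only [Finset.mem_filter, Finset.mem_univ, true_and] at hw hw'
      exact hc1 u w w' hw hw' h) (ho' u)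
  have hmiss2 : ∀ w, (Finset.univ.filter fun c =>
      c ∉ (Finset.univ.filter fun u => R u w).image fun u => col u w).card ≤ D := fun w =>
    card_missing_colors_le _ _ (fun u hu u' hu' h => by
      simp only [Finset.mem_filter, Finset.mem_univ, true_and] at hu hu'
      exact hc2 u u' w hu hu' h) (hi' w)
  obtain ⟨τ, hτ1, hτ2⟩ := exists_balanced_shifts (C := C) (m := m) (D := (D : ℝ)) cl hb hγ hclb
    (fun u c => c ∉ (Finset.univ.filter fun w => R u w).image (col u))
    (fun j u c => ∃ w, E j u w ∧ col u w = c) cj (fun u => Nat.cast_le.2 (by convert hmiss1 u)) (by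
      intro j
      refine (hm j).trans ?_
      norm_cast
      rw [Finset.card_eq_sum_card_fiberwise (f := Prod.fst) (t := Finset.univ)
        (by simp [Set.MapsTo])]
      refine Finset.sum_le_sum fun v _ => ?_
      refine Finset.card_le_card_of_injOn (fun p => col p.1 p.2) ?_ ?_
      · rintro ⟨x, y⟩ h
        simp only [Finset.coe_filter, Finset.mem_univ, true_and, Set.mem_ofPred_eq,
          Finset.mem_filter] at h ⊢
        obtain ⟨h, rfl⟩ := h
        exact ⟨y, h, rfl⟩
      · rintro ⟨x, y⟩ h ⟨x', y'⟩ h' e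
        simp only [Finset.coe_filter, Finset.mem_univ, true_and, Set.mem_ofPred_eq,
          Finset.mem_filter] at h h' e
        obtain ⟨h, rfl⟩ := h
        obtain ⟨h', rfl⟩ := h'
        rw [hc1 _ _ _ (hE _ _ _ h) (hE _ _ _ h') e]) hexp
  refine ⟨fun c u w => R u w ∧ col u w = c + τ (cl u), fun c u w h => h.1,
    fun c u w w' h h' => hc1 u w w' h.1 h'.1 (h.2.trans h'.2.symm),
    fun c u u' w h h' => hc2 u u' w h.1 h'.1 (h.2.trans (by rw [hcl u u' w h.1 h'.1, h'.2])),
    fun c c' u w h h' => add_left_injective _ (h.2.symm.trans h'.2), fun u => ?_, fun w => ?_,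
    fun c => ?_, fun j => ?_⟩
  · refine le_trans (Finset.card_le_card_of_injOn (fun c => c + τ (cl u)) ?_
      (add_left_injective _).injOn) (hmiss1 u)
    intro c hc
    simp only [Finset.coe_filter, Finset.mem_univ, true_and, Set.mem_ofPred_eq, Finset.mem_image,
      Finset.mem_filter, not_exists, not_and] at hc ⊢
    exact hc
  · by_cases hex : ∃ u₀, R u₀ w
    · obtain ⟨u₀, hu₀⟩ := hex
      refine le_trans (Finset.card_le_card_of_injOn (fun c => c + τ (cl u₀)) ?_
        (add_left_injective _).injOn) (hmiss2 w)
      intro c hc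
      simp only [Finset.coe_filter, Finset.mem_univ, true_and, Set.mem_ofPred_eq, Finset.mem_image,
        Finset.mem_filter, not_exists, not_and] at hc ⊢
      intro u hu
      rw [← hcl u u₀ w hu hu₀]
      exact hc u hu
    · push Not at hex
      refine le_trans (Finset.card_le_univ _) ((hi' w).trans ?_)
      simp [hex]
  · refine le_trans (Nat.cast_le.2 (Finset.card_le_card fun u hu => ?_)) (hτ1 c)
    simp only [Finset.mem_univ, true_and, Finset.mem_image,
      Finset.mem_filter, not_exists, not_and] at hu ⊢
    exact hu
  · refine (hτ2 j).trans (Nat.cast_le.2 (Finset.card_le_card fun u hu => ?_))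
    simp only [Finset.mem_univ, true_and, Finset.mem_filter] at hu ⊢
    obtain ⟨w, h1, h2⟩ := hu
    exact ⟨w, h1, hE _ _ _ h1, h2⟩

theorem card_mul_le_card_filter_of_fibers {α β : Type*} [Fintype α] (S : Finset β) (f : α → β)
    (p : α → Prop)
    [DecidablePred p] (q : β → α → Prop) [∀ x, DecidablePred (q x)] {e : ℝ}
    (h : ∀ x ∈ S, e ≤ (Finset.univ.filter fun z => q x z).card)
    (hq : ∀ x ∈ S, ∀ z, q x z → p z ∧ f z = x) :
    S.card * e ≤ (Finset.univ.filter fun z => p z).card := by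
  have h1 : (S.card : ℝ) * e ≤ ∑ x ∈ S, ((Finset.univ.filter fun z => q x z).card : ℝ) := by
    rw [← nsmul_eq_mul]
    exact Finset.card_nsmul_le_sum _ _ _ h
  refine h1.trans ?_
  norm_cast
  rw [← Finset.card_biUnion]
  · refine Finset.card_le_card fun z hz => ?_
    simp only [Finset.mem_biUnion, Finset.mem_filter, Finset.mem_univ, true_and] at hz ⊢
    obtain ⟨x, hx, hxz⟩ := hz
    exact (hq x hx z hxz).1
  · intro x hx y hy hxy
    rw [Function.onFun, Finset.disjoint_filter]
    intro z _ h1 h2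
    exact hxy ((hq x hx z h1).2.symm.trans (hq y hy z h2).2)

theorem card_filter_prod_le {α β : Type*} [Fintype α] [Fintype β] (p : α × β → Prop)
    [DecidablePred p] (N : ℕ)
    (h : ∀ a, (Finset.univ.filter fun b => p (a, b)).card ≤ N) :
    (Finset.univ.filter p).card ≤ Fintype.card α * N := by
  rw [Finset.card_eq_sum_card_fiberwise (f := Prod.fst) (t := Finset.univ) (by simp [Set.MapsTo])]
  refine (Finset.sum_le_card_nsmul _ _ N fun a _ => ?_).trans (by simp)
  refine le_trans (Finset.card_le_card_of_injOn Prod.snd ?_ ?_) (h a)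
  · rintro ⟨a', b⟩ hb
    simp only [Finset.coe_filter, Finset.mem_filter, Finset.mem_univ, true_and,
      Set.mem_ofPred_eq] at hb ⊢
    obtain ⟨hb, rfl⟩ := hb
    exact hb
  · rintro ⟨a', b⟩ hb ⟨a'', b'⟩ hb' e
    simp only [Finset.coe_filter, Finset.mem_filter, Finset.mem_univ, true_and,
      Set.mem_ofPred_eq] at hb hb' e
    rw [hb.2, hb'.2, e]

theorem card_filter_fst_le {α β : Type*} [Fintype α] [Fintype β] (p : α → Prop)
    [DecidablePred p] :
    (Finset.univ.filter fun c : α × β => p c.1).card ≤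
      (Finset.univ.filter p).card * Fintype.card β := by
  have : (Finset.univ.filter fun c : α × β => p c.1) = (Finset.univ.filter p) ×ˢ Finset.univ := by
    ext c; simp
  rw [this, Finset.card_product, Finset.card_univ]

section ClusterPosition

variable {k : ℕ}

/-- The position of the cluster `X` in the cyclic order `x₀, x₀ + d, x₀ + 2 d, …`. -/
def clusterPos (d x₀ X : ZMod k) : ℕ := ((X - x₀) * d⁻¹).val

variable [Fact k.Prime] {d x₀ X : ZMod k}

theorem clusterPos_lt : clusterPos d x₀ X < k := ZMod.val_lt _

theorem clusterPos_add (hd : d ≠ 0) (h : clusterPos d x₀ X + 1 < k) :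
    clusterPos d x₀ (X + d) = clusterPos d x₀ X + 1 := by
  have e : (X + d - x₀) * d⁻¹ = (X - x₀) * d⁻¹ + 1 := by field_simp; ring
  unfold clusterPos at *
  rw [e, ZMod.val_add_of_lt, ZMod.val_one]
  rwa [ZMod.val_one]

theorem eq_of_clusterPos_eq (hd : d ≠ 0) {a : ℕ} (h : clusterPos d x₀ X = a) : X = x₀ + a * d := by
  have : (((X - x₀) * d⁻¹).val : ZMod k) = a := by
    exact_mod_cast congrArg (Nat.cast (R := ZMod k)) h
  rw [ZMod.natCast_zmod_val] at this
  rw [← this]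
  field_simp
  ring

theorem eq_of_clusterPos_add_one_eq (hd : d ≠ 0) (h : clusterPos d x₀ X + 1 = k) : x₀ = X + d := by
  have h1 : clusterPos d x₀ X = k - 1 := by omega
  have h2 := eq_of_clusterPos_eq hd h1
  have hk : 1 ≤ k := (Fact.out : k.Prime).one_lt.le
  rw [h2, Nat.cast_sub hk]
  simp

theorem clusterPos_add_eq_zero (hd : d ≠ 0) (h : clusterPos d x₀ X + 1 = k) :
    clusterPos d x₀ (X + d) = 0 := by
  rw [← eq_of_clusterPos_add_one_eq hd h]
  simp [clusterPos]

theorem card_filter_val (p : ℕ → Prop) [DecidablePred p] :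
    (Finset.univ.filter fun z : ZMod k => p z.val).card = ((Finset.range k).filter p).card := by
  refine Finset.card_bij (fun z _ => z.val) ?_ ?_ ?_
  · intro z hz
    simpa [ZMod.val_lt] using hz
  · intro z _ z' _ h
    exact ZMod.val_injective k h
  · intro a ha
    simp only [Finset.mem_filter, Finset.mem_range] at ha
    exact ⟨(a : ZMod k), by simp [ZMod.val_cast_of_lt ha.1, ha.2], ZMod.val_cast_of_lt ha.1⟩

theorem card_filter_clusterPos (hd : d ≠ 0) (x₀ : ZMod k) (p : ℕ → Prop) [DecidablePred p] :
    (Finset.univ.filter fun X => p (clusterPos d x₀ X)).card =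
      ((Finset.range k).filter p).card := by
  rw [← card_filter_val]
  refine Finset.card_bij (fun X _ => (X - x₀) * d⁻¹) (fun X hX => by
      simp only [Finset.mem_filter, Finset.mem_univ, true_and] at hX ⊢; exact hX)
    (fun X _ Y _ h => ?_) (fun z hz => ⟨z * d + x₀, ?_, ?_⟩)
  · simpa [hd] using h
  · simp only [Finset.mem_filter, Finset.mem_univ, true_and] at hz ⊢
    simpa [clusterPos, hd] using hz
  · simp [hd]

theorem card_filter_clusterPos' (hd : d ≠ 0) (X : ZMod k) (p : ℕ → Prop) [DecidablePred p] :
    (Finset.univ.filter fun x₀ => p (clusterPos d x₀ X)).card =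
      ((Finset.range k).filter p).card := by
  rw [← card_filter_val]
  refine Finset.card_bij (fun x₀ _ => (X - x₀) * d⁻¹) (fun x₀ hX => by
      simp only [Finset.mem_filter, Finset.mem_univ, true_and] at hX ⊢; exact hX)
    (fun x _ Y _ h => ?_) (fun z hz => ⟨X - z * d, ?_, ?_⟩)
  · simpa [hd] using h
  · simp only [Finset.mem_filter, Finset.mem_univ, true_and] at hz ⊢
    simpa [clusterPos, hd] using hz
  · simp [hd]

end ClusterPosition

theorem card_filter_range_lt {k s : ℕ} (h : s ≤ k) :
    ((Finset.range k).filter (· < s)).card = s := by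
  have : (Finset.range k).filter (· < s) = Finset.range s := by
    ext a; simp only [Finset.mem_filter, Finset.mem_range]; omega
  rw [this, Finset.card_range]

theorem card_filter_range_between (k s : ℕ) :
    ((Finset.range k).filter fun a => s ≤ a ∧ a + 1 < k).card = k - 1 - s := by
  have : ((Finset.range k).filter fun a => s ≤ a ∧ a + 1 < k) = Finset.Ico s (k - 1) := by
    ext a; simp only [Finset.mem_filter, Finset.mem_range, Finset.mem_Ico]; omega
  rw [this, Nat.card_Ico]

/-- The edges that shift the cluster by `d` and do not lie in a reserved class. -/
def ClusterEdge {V Γ : Type*} {k : ℕ} [AddCommGroup Γ] (G : V → V → Prop) (ℓ : V → ZMod k × Γ)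
    (κ : Γ → ℕ) (d : ZMod k) (u w : V) : Prop :=
  G u w ∧ (ℓ w).1 = (ℓ u).1 + d ∧ κ ((ℓ w).2 - (ℓ u).2) = 0

theorem card_insertion_pairs {V Γ : Type*} [Fintype V] [AddCommGroup Γ] [DecidableEq Γ] {k s : ℕ}
    [Fact k.Prime]
    {G : V → V → Prop} {ℓ : V → ZMod k × Γ} {κ : Γ → ℕ} {g₄ g₅ : Γ} (hg₄ : κ g₄ = 4)
    (hg₅ : κ g₅ = 5) (hg₄₅ : κ (g₄ + g₅) = 0) {e : ℝ}
    (hio : ∀ v l m, e ≤ (Finset.univ.filter fun z : V × V =>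
      G z.1 v ∧ G v z.2 ∧ G z.1 z.2 ∧ ℓ z.1 = l ∧ ℓ z.2 = m).card)
    {d : ZMod k} (hd : d ≠ 0) (x₀ : ZMod k) (v : V) :
    ((k - 1 - s : ℕ) : ℝ) * e ≤ (Finset.univ.filter fun p : V × V =>
      (G p.1 v ∧ κ ((ℓ v).2 - (ℓ p.1).2) = 4) ∧ (G v p.2 ∧ κ ((ℓ p.2).2 - (ℓ v).2) = 5) ∧
        ClusterEdge G ℓ κ d p.1 p.2 ∧ s ≤ clusterPos d x₀ (ℓ p.1).1 ∧
          clusterPos d x₀ (ℓ p.1).1 + 1 < k).card := by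
  have hS : (Finset.univ.filter fun X : ZMod k =>
      s ≤ clusterPos d x₀ X ∧ clusterPos d x₀ X + 1 < k).card = k - 1 - s := by
    rw [← card_filter_range_between k s]
    exact card_filter_clusterPos hd x₀ fun a => s ≤ a ∧ a + 1 < k
  rw [← hS]
  refine card_mul_le_card_filter_of_fibers _ (fun z => (ℓ z.1).1) _
    (fun X (z : V × V) => G z.1 v ∧ G v z.2 ∧ G z.1 z.2 ∧ ℓ z.1 = (X, (ℓ v).2 - g₄) ∧
      ℓ z.2 = (X + d, (ℓ v).2 + g₅)) (fun X _ => hio _ _ _) ?_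
  intro X hX z hz
  simp only [Finset.mem_filter, Finset.mem_univ, true_and] at hX
  obtain ⟨h1, h2, h3, h4, h5⟩ := hz
  simp only [ClusterEdge, h4, h5, h1, h2, h3, true_and, sub_sub_cancel, add_sub_cancel_left, hg₄,
    hg₅, and_true]
  refine ⟨?_, hX⟩
  rw [← hg₄₅]
  congr 1
  abel

theorem card_linking_pairs {V Γ : Type*} [Fintype V] [AddCommGroup Γ] [DecidableEq Γ] {k s : ℕ}
    [Fact k.Prime]
    {G : V → V → Prop} {ℓ : V → ZMod k × Γ} {κ : Γ → ℕ}
    (hκ : ∀ a b, ∃ h₁ h₂, κ (h₁ - a) = 1 ∧ κ (h₂ - h₁) = 2 ∧ κ (b - h₂) = 3) {e : ℝ}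
    (hoi : ∀ u v l m, e ≤ (Finset.univ.filter fun z : V × V =>
      G u z.1 ∧ G z.2 v ∧ G z.1 z.2 ∧ ℓ z.1 = l ∧ ℓ z.2 = m).card) (hsk : s ≤ k)
    {d : ZMod k} (hd : d ≠ 0) (x₀ : ZMod k) (x y : V) :
    (s : ℝ) ^ 2 * e ≤ (Finset.univ.filter fun p : V × V =>
      ¬ s ≤ clusterPos d x₀ (ℓ p.1).1 ∧ ¬ s ≤ clusterPos d x₀ (ℓ p.2).1 ∧
        (G x p.1 ∧ κ ((ℓ p.1).2 - (ℓ x).2) = 1) ∧ (G p.1 p.2 ∧ κ ((ℓ p.2).2 - (ℓ p.1).2) = 2) ∧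
        (G p.2 y ∧ κ ((ℓ y).2 - (ℓ p.2).2) = 3)).card := by
  obtain ⟨h₁, h₂, e1, e2, e3⟩ := hκ (ℓ x).2 (ℓ y).2
  have hS : (Finset.univ.filter fun X => clusterPos d x₀ X < s).card = s :=
    (card_filter_clusterPos hd x₀ (· < s)).trans (card_filter_range_lt hsk)
  have := card_mul_le_card_filter_of_fibers
    ((Finset.univ.filter fun X => clusterPos d x₀ X < s) ×ˢ
      (Finset.univ.filter fun X => clusterPos d x₀ X < s))
    (fun z : V × V => ((ℓ z.1).1, (ℓ z.2).1))
    (fun p => ¬ s ≤ clusterPos d x₀ (ℓ p.1).1 ∧ ¬ s ≤ clusterPos d x₀ (ℓ p.2).1 ∧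
      (G x p.1 ∧ κ ((ℓ p.1).2 - (ℓ x).2) = 1) ∧ (G p.1 p.2 ∧ κ ((ℓ p.2).2 - (ℓ p.1).2) = 2) ∧
      (G p.2 y ∧ κ ((ℓ y).2 - (ℓ p.2).2) = 3))
    (fun X z => G x z.1 ∧ G z.2 y ∧ G z.1 z.2 ∧ ℓ z.1 = (X.1, h₁) ∧ ℓ z.2 = (X.2, h₂))
    (fun X _ => hoi _ _ _ _) (by
      rintro ⟨X, Y⟩ hX ⟨z, z'⟩ ⟨a1, a2, a3, a4, a5⟩
      simp only [Finset.mem_product, Finset.mem_filter, Finset.mem_univ, true_and] at hX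
      simp only at a1 a2 a3 a4 a5
      simp [a1, a2, a3, a4, a5, e1, e2, e3, hX])
  rw [Finset.card_product, hS, Nat.cast_mul, ← sq] at this
  exact this

/-- Edge-disjoint Hamilton cycles from a sufficiently regular labelling of the vertices by pairs of
a cluster and a group element, where the group elements determine the reserved edges. -/
theorem exists_hamilton_cycles_of_labelling {V Γ : Type*} [Fintype V] [Nonempty V]
    [AddCommGroup Γ] [DecidableEq Γ] {k r s D P Q : ℕ} [Fact k.Prime] [NeZero r] (G : V → V → Prop)
    (hG : ∀ v, ¬ G v v) (ℓ : V → ZMod k × Γ) (κ : Γ → ℕ)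
    (hκ : ∀ a b, ∃ h₁ h₂, κ (h₁ - a) = 1 ∧ κ (h₂ - h₁) = 2 ∧ κ (b - h₂) = 3)
    (hκ' : ∃ g g', κ g = 4 ∧ κ g' = 5 ∧ κ (g + g') = 0)
    {e b γ : ℝ} (hb : 0 < b) (hγ : 0 ≤ γ)
    (hcl : ∀ X, ((Finset.univ.filter fun v => (ℓ v).1 = X).card : ℝ) ≤ b)
    (ho : ∀ d ≠ 0, ∀ u, (Finset.univ.filter fun w => ClusterEdge G ℓ κ d u w).card ≤ k * r)
    (hi : ∀ d ≠ 0, ∀ w, (Finset.univ.filter fun u => ClusterEdge G ℓ κ d u w).card ≤ k * r)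
    (ho' : ∀ d ≠ 0, ∀ u, k * r ≤ (Finset.univ.filter fun w => ClusterEdge G ℓ κ d u w).card + D)
    (hi' : ∀ d ≠ 0, ∀ w, k * r ≤ (Finset.univ.filter fun u => ClusterEdge G ℓ κ d u w).card + D)
    (hoi : ∀ u v l m, e ≤ (Finset.univ.filter fun z : V × V =>
      G u z.1 ∧ G z.2 v ∧ G z.1 z.2 ∧ ℓ z.1 = l ∧ ℓ z.2 = m).card)
    (hio : ∀ v l m, e ≤ (Finset.univ.filter fun z : V × V =>
      G z.1 v ∧ G v z.2 ∧ G z.1 z.2 ∧ ℓ z.1 = l ∧ ℓ z.2 = m).card)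
    (hs : 1 ≤ s) (hsk : s + 1 ≤ k)
    (hexp : ((k * r : ℕ) + (k * r : ℕ) * (Fintype.card V : ℝ)) * Real.exp (-2 * γ ^ 2 * k) < 1)
    (hP : b + (Fintype.card V * D / (k * r : ℕ) + γ * k * b) ≤ P) (hP' : (k - 1) * (r + D) ≤ P)
    (hQ : s * b ≤ Q) (hQ' : (k - 1) * (s * r) ≤ Q)
    (hlink : ((P * (6 * Fintype.card V + (k - 1) * (k * r)) : ℕ) : ℝ) < (s : ℝ) ^ 2 * e)
    (hins : 3 * (Q : ℝ) < ((k - 1 - s : ℕ) : ℝ) * e / (k * r : ℕ) - γ * k * b) :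
    ∃ σ : {d : ZMod k // d ≠ 0} × (ZMod k × ZMod r) → Equiv.Perm V, (∀ i, IsHamCycle G (σ i)) ∧
      ∀ i j, i ≠ j → ∀ v, σ i v ≠ σ j v := by
  obtain ⟨g₄, g₅, hg₄, hg₅, hg₄₅⟩ := hκ'
  have hC : Fintype.card (ZMod k × ZMod r) = k * r := by
    rw [Fintype.card_prod, ZMod.card, ZMod.card]
  have hA : Fintype.card {d : ZMod k // d ≠ 0} = k - 1 := by
    rw [Fintype.card_subtype_compl, ZMod.card]
    simp
  let R : ZMod k → V → V → Prop := ClusterEdge G ℓ κ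
  let E : ZMod k → (ZMod k × ZMod r) × V → V → V → Prop := fun d j x y =>
    (G x j.2 ∧ κ ((ℓ j.2).2 - (ℓ x).2) = 4) ∧ (G j.2 y ∧ κ ((ℓ y).2 - (ℓ j.2).2) = 5) ∧ R d x y ∧
      s ≤ clusterPos d j.1.1 (ℓ x).1 ∧ clusterPos d j.1.1 (ℓ x).1 + 1 < k
  have hE : ∀ d ≠ 0, ∀ j, ((k - 1 - s : ℕ) : ℝ) * e ≤
      (Finset.univ.filter fun p : V × V => E d j p.1 p.2).card := by
    intro d hd j
    exact card_insertion_pairs hg₄ hg₅ hg₄₅ hio hd j.1.1 j.2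
  choose F hFR hF1 hF2 hFc hFo hFi hFm hFE using fun d : {d : ZMod k // d ≠ 0} =>
    exists_balanced_edge_coloring (C := ZMod k × ZMod r) (J := (ZMod k × ZMod r) × V)
      (m := ((k - 1 - s : ℕ) : ℝ) * e) (R d) (fun v => (ℓ v).1)
      (fun u u' w h h' => add_left_injective d.1 (h.2.1.symm.trans h'.2.1)) D
      (fun u => (ho d d.2 u).trans_eq hC.symm) (fun u => (hi d d.2 u).trans_eq hC.symm)
      (fun u => hC.trans_le (ho' d d.2 u)) (fun u => hC.trans_le (hi' d d.2 u)) hb hγ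
        (fun x => by convert hcl x)
      (E d) Prod.fst (fun j u w h => h.2.2.1) (fun j => by convert hE d d.2 j) (by
        rw [Fintype.card_prod _ V, hC, ZMod.card]
        push_cast at hexp ⊢
        exact hexp)
  simp only [ZMod.card, hC] at hFm hFE
  let pos : {d : ZMod k // d ≠ 0} × (ZMod k × ZMod r) → V → ℕ := fun i v =>
    clusterPos i.1.1 i.2.1 (ℓ v).1
  have hposk : ∀ i v, pos i v < k := fun i v => clusterPos_lt
  have hRpos : ∀ i u w, R i.1 u w → pos i u + 1 < k → pos i w = pos i u + 1 := by
    intro i u w h hk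
    simp only [pos, h.2.1]
    exact clusterPos_add i.1.2 hk
  have hRpos0 : ∀ i u w, R i.1 u w → pos i u + 1 = k → pos i w = 0 := by
    intro i u w h hk
    simp only [pos, h.2.1]
    exact clusterPos_add_eq_zero i.1.2 hk
  have hRpos' : ∀ i u w, R i.1 u w → s ≤ pos i w → pos i w = pos i u + 1 := by
    intro i u w h hw
    rcases lt_or_eq_of_le (Nat.succ_le_of_lt (hposk i u)) with h1 | h1
    · exact hRpos i u w h h1
    · have := hRpos0 i u w h h1
      omega
  let F' : {d : ZMod k // d ≠ 0} × (ZMod k × ZMod r) → V → V → Prop := fun i u w =>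
    F i.1 i.2 u w ∧ s ≤ pos i u ∧ s ≤ pos i w
  have hout : ∀ i x, s ≤ pos i x → (∀ w, ¬ F' i x w) →
      i.2.1 = (ℓ x).1 + i.1.1 ∨ ∀ w, ¬ F i.1 i.2 x w := by
    intro i x hx h
    by_contra hc
    push Not at hc
    obtain ⟨h1, w, hw⟩ := hc
    rcases lt_or_eq_of_le (Nat.succ_le_of_lt (hposk i x)) with h2 | h2
    · have := hRpos i x w (hFR _ _ _ _ hw) h2
      exact h w ⟨hw, hx, by omega⟩
    · exact h1 (eq_of_clusterPos_add_one_eq i.1.2 h2)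
  have hin : ∀ i y, s ≤ pos i y → (∀ u, ¬ F' i u y) →
      i.2.1 = (ℓ y).1 - s * i.1.1 ∨ ∀ u, ¬ F i.1 i.2 u y := by
    intro i y hy h
    by_contra hc
    push Not at hc
    obtain ⟨h1, u, hu⟩ := hc
    have h2 := hRpos' i u y (hFR _ _ _ _ hu) hy
    have h3 : ¬ s ≤ pos i u := fun h4 => h u ⟨hu, h4, hy⟩
    have h4 : pos i y = s := by omega
    exact h1 (by rw [eq_of_clusterPos_eq i.1.2 h4]; ring)
  have hcount : ∀ (f : {d : ZMod k // d ≠ 0} → ZMod k)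
      (p : {d : ZMod k // d ≠ 0} × (ZMod k × ZMod r) → Prop),
      (∀ d, (Finset.univ.filter fun c => p (d, c)).card ≤ D) →
      (Finset.univ.filter fun i : {d : ZMod k // d ≠ 0} × (ZMod k × ZMod r) =>
        i.2.1 = f i.1 ∨ p i).card ≤ P := by
    intro f p hp
    refine le_trans (card_filter_prod_le (fun i : {d : ZMod k // d ≠ 0} × (ZMod k × ZMod r) =>
      i.2.1 = f i.1 ∨ p i) (r + D) fun d => ?_) (hA ▸ hP')
    rw [Finset.filter_or]
    refine (Finset.card_union_le _ _).trans (Nat.add_le_add ?_ (hp d))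
    refine (card_filter_fst_le fun x => x = f d).trans ?_
    have : (Finset.univ.filter fun x => x = f d).card ≤ 1 :=
      Finset.card_le_one.2 fun a ha b hb => by
        simp only [Finset.mem_filter] at ha hb; rw [ha.2, hb.2]
    rw [ZMod.card]
    nlinarith
  refine exists_hamilton_cycles_of_path_systems G hG (fun u w => κ ((ℓ w).2 - (ℓ u).2))
    (fun i => Finset.univ.filter fun v => s ≤ pos i v) F' pos ?_ ?_ ?_ ?_ ?_ ?_ P Q ?_ ?_ ?_ ?_ ?_
    ?_ ?_
  · intro i u w h
    simpa using h.2
  · intro i u w w' h h'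
    exact hF1 _ _ _ _ _ h.1 h'.1
  · intro i u u' w h h'
    exact hF2 _ _ _ _ _ h.1 h'.1
  · intro i u w h
    have := hRpos' i u w (hFR _ _ _ _ h.1) h.2.2
    omega
  · intro i u w h
    exact ⟨(hFR _ _ _ _ h.1).1, (hFR _ _ _ _ h.1).2.2⟩
  · rintro ⟨d, c⟩ ⟨d', c'⟩ u w h h'
    have h1 := (hFR _ _ _ _ h.1).2.1
    have h2 := (hFR _ _ _ _ h'.1).2.1
    have h3 : d = d' := Subtype.ext (add_right_injective _ (h1.symm.trans h2))
    subst h3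
    rw [hFc d c c' u w h.1 h'.1]
  · intro i
    have h1 := hFm i.1 i.2
    have h2 := hcl (i.2.1 - i.1.1)
    have h3 : (((Finset.univ.filter fun v => s ≤ pos i v).filter fun x =>
        ∀ w, ¬ F' i x w).card : ℝ) ≤
        (Finset.univ.filter fun v => (ℓ v).1 = i.2.1 - i.1.1).card +
          (Finset.univ.filter fun u => ∀ w, ¬ F i.1 i.2 u w).card := by
      norm_cast
      refine (Finset.card_le_card fun x hx => ?_).trans (Finset.card_union_le _ _)
      simp only [Finset.mem_filter, Finset.mem_univ, true_and, Finset.mem_union] at hx ⊢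
      refine (hout i x hx.1 hx.2).imp_left fun h => ?_
      rw [h]; ring
    have h4 := h3.trans ((add_le_add h2 h1).trans hP)
    convert (Nat.cast_le (α := ℝ)).1 h4
  · intro x
    refine (Finset.card_le_card fun i hi => ?_).trans
      (hcount (fun d => (ℓ x).1 + d.1) (fun i => ∀ w, ¬ F i.1 i.2 x w) fun d => by convert hFo d x)
    simp only [Finset.mem_filter, Finset.mem_univ, true_and] at hi ⊢
    exact hout i x hi.1 hi.2
  · intro y
    refine (Finset.card_le_card fun i hi => ?_).trans
      (hcount (fun d => (ℓ y).1 - s * d.1) (fun i => ∀ u, ¬ F i.1 i.2 u y) fun d =>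
        by convert hFi d y)
    simp only [Finset.mem_filter, Finset.mem_univ, true_and] at hi ⊢
    exact hin i y hi.1 hi.2
  · intro i
    have h1 : ((Finset.univ.filter fun v => pos i v < s).card : ℝ) ≤ s * b := by
      have hS := (card_filter_clusterPos i.1.2 i.2.1 (· < s)).trans
        (card_filter_range_lt (by omega : s ≤ k))
      have h0 : ((Finset.univ.filter fun v => pos i v < s).card : ℝ) ≤
          (Finset.univ.filter fun X => clusterPos i.1.1 i.2.1 X < s).card * b := by
        rw [Finset.card_eq_sum_card_fiberwise (f := fun v => (ℓ v).1)
          (t := Finset.univ.filter fun X => clusterPos i.1.1 i.2.1 X < s)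
          (fun v hv => by simpa [pos] using hv)]
        push_cast
        refine (Finset.sum_le_card_nsmul _ _ b fun X _ => (le_trans ?_ (hcl X))).trans_eq
          (nsmul_eq_mul _ _)
        exact_mod_cast Finset.card_le_card (Finset.filter_subset_filter _ (Finset.subset_univ _))
      rwa [hS] at h0
    have h2 : (Finset.univ.filter fun v => pos i v < s).card ≤ Q := by exact_mod_cast h1.trans hQ
    simpa using h2
  · intro v
    refine le_trans ?_ hQ'
    rw [← hA]
    refine card_filter_prod_le _ (s * r) fun d => ?_
    have hS := (card_filter_clusterPos' d.2 (ℓ v).1 (· < s)).trans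
      (card_filter_range_lt (by omega : s ≤ k))
    have := card_filter_fst_le (α := ZMod k) (β := ZMod r) fun x₀ => clusterPos d.1 x₀ (ℓ v).1 < s
    rw [hS, ZMod.card] at this
    simpa [pos] using this
  · intro i x y
    rw [Fintype.card_prod, hA, hC]
    have h1 := hlink.trans_le (card_linking_pairs hκ hoi (by omega : s ≤ k) i.1.2 i.2.1 x y)
    have h2 := (Nat.cast_lt (α := ℝ)).1 h1
    simpa only [Finset.mem_filter, Finset.mem_univ, true_and] using h2
  · intro i v _
    have h1 := hins.trans_le (hFE i.1 (i.2, v))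
    have h2 := (Nat.cast_lt (α := ℝ)).1
      ((by push_cast; rfl : ((3 * Q : ℕ) : ℝ) = 3 * Q).trans_lt h1)
    refine h2.trans_le (Finset.card_le_card fun x hx => ?_)
    simp only [Finset.mem_filter, Finset.mem_univ, true_and] at hx ⊢
    obtain ⟨y, ⟨h1, h2, h3, h4, h5⟩, h6⟩ := hx
    refine ⟨y, ⟨h6, h4, ?_⟩, h1, h2⟩
    have := hRpos i x y h3 h5
    have h4' : s ≤ pos i x := h4
    omega

section ReservedClasses

variable {q : ℕ}

/-- A distribution of the elements of the group into the class `0` and five reserved classes. -/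
noncomputable def reservedClass (g : ZMod q × ZMod q) : ℕ :=
  if g.2 = 0 ∧ g.1 ≠ 0 then 1 else if g.1 = 0 ∧ g.2 ≠ 0 then 3
  else if g = (1, 1) ∨ g = (2, 2) ∨ g = (3, 3) then 2
  else if g = (1, 2) then 4 else if g = (1, 3) then 5 else 0

theorem natCast_zmod_ne {a b : ℕ} (hab : a < b) (hb : b < q) : (a : ZMod q) ≠ b := by
  rw [Ne, ZMod.natCast_eq_natCast_iff', Nat.mod_eq_of_lt (hab.trans hb), Nat.mod_eq_of_lt hb]
  exact hab.ne

theorem exists_reservedClass_path (hq : 7 ≤ q) (a b : ZMod q × ZMod q) :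
    ∃ h₁ h₂, reservedClass (h₁ - a) = 1 ∧ reservedClass (h₂ - h₁) = 2 ∧
      reservedClass (b - h₂) = 3 := by
  have n01 := natCast_zmod_ne (q := q) (show 0 < 1 by lia) (by lia)
  have n02 := natCast_zmod_ne (q := q) (show 0 < 2 by lia) (by lia)
  have n03 := natCast_zmod_ne (q := q) (show 0 < 3 by lia) (by lia)
  have n12 := natCast_zmod_ne (q := q) (show 1 < 2 by lia) (by lia)
  have n13 := natCast_zmod_ne (q := q) (show 1 < 3 by lia) (by lia)
  have n23 := natCast_zmod_ne (q := q) (show 2 < 3 by lia) (by lia)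
  push_cast at n01 n02 n03 n12 n13 n23
  obtain ⟨c, hc, hc0, h1, h2⟩ : ∃ c : ZMod q, (c = 1 ∨ c = 2 ∨ c = 3) ∧ c ≠ 0 ∧ c ≠ b.1 - a.1 ∧
      c ≠ b.2 - a.2 := by
    by_cases h1 : (1 : ZMod q) ≠ b.1 - a.1 ∧ 1 ≠ b.2 - a.2
    · exact ⟨1, by simp, n01.symm, h1⟩
    by_cases h2 : (2 : ZMod q) ≠ b.1 - a.1 ∧ 2 ≠ b.2 - a.2
    · exact ⟨2, by simp, n02.symm, h2⟩
    refine ⟨3, by simp, n03.symm, ?_⟩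
    grind
  refine ⟨(b.1 - c, a.2), (b.1, a.2 + c), ?_, ?_, ?_⟩
  · have : b.1 - c - a.1 ≠ 0 := fun h => h1 (by linear_combination -h)
    simp [reservedClass, this]
  · rcases hc with rfl | rfl | rfl <;> simp_all [reservedClass]
  · have : b.2 - (a.2 + c) ≠ 0 := fun h => h2 (by linear_combination -h)
    simp [reservedClass, this]

theorem exists_reservedClass_triangle (hq : 7 ≤ q) :
    ∃ g g' : ZMod q × ZMod q, reservedClass g = 4 ∧ reservedClass g' = 5 ∧
      reservedClass (g + g') = 0 := by
  have n01 := natCast_zmod_ne (q := q) (show 0 < 1 by lia) (by lia)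
  have n02 := natCast_zmod_ne (q := q) (show 0 < 2 by lia) (by lia)
  have n03 := natCast_zmod_ne (q := q) (show 0 < 3 by lia) (by lia)
  have n05 := natCast_zmod_ne (q := q) (show 0 < 5 by lia) (by lia)
  have n12 := natCast_zmod_ne (q := q) (show 1 < 2 by lia) (by lia)
  have n13 := natCast_zmod_ne (q := q) (show 1 < 3 by lia) (by lia)
  have n23 := natCast_zmod_ne (q := q) (show 2 < 3 by lia) (by lia)
  have n25 := natCast_zmod_ne (q := q) (show 2 < 5 by lia) (by lia)
  push_cast at n01 n02 n03 n05 n12 n13 n23 n25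
  have e : ((1, 2) + (1, 3) : ZMod q × ZMod q) = (2, 5) := by
    rw [Prod.mk_add_mk]; norm_num
  refine ⟨(1, 2), (1, 3), ?_, ?_, ?_⟩
  · simp [reservedClass, n01.symm, n02.symm, n12, n12.symm, n13, n23]
  · simp [reservedClass, n01.symm, n03.symm, n12, n13, n13.symm, n23.symm]
  · rw [e]
    simp [reservedClass, n02.symm, n05.symm, n12.symm, n23, n25.symm]

theorem sq_le_card_filter_reservedClass_eq_zero [NeZero q] :
    q ^ 2 ≤ (Finset.univ.filter fun g : ZMod q × ZMod q => reservedClass g = 0).card +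
      (2 * q + 5) := by
  have h : (Finset.univ : Finset (ZMod q × ZMod q)) ⊆
      (Finset.univ.filter fun g => reservedClass g = 0) ∪
        ((Finset.univ ×ˢ {0} ∪ {0} ×ˢ Finset.univ) ∪
          {(1, 1), (2, 2), (3, 3), (1, 2), (1, 3)}) := by
    intro g _
    simp only [Finset.mem_union, Finset.mem_univ, true_and, and_true,
      Finset.mem_product, Finset.mem_insert, Finset.mem_singleton, reservedClass]
    grind
  have h1 := Finset.card_le_card h
  rw [Finset.card_univ, Fintype.card_prod, ZMod.card] at h1
  have h2 : (Finset.univ ×ˢ {0} ∪ {0} ×ˢ Finset.univ : Finset (ZMod q × ZMod q)).card ≤ q + q := by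
    refine (Finset.card_union_le _ _).trans ?_
    simp [ZMod.card]
  have h3 : ({(1, 1), (2, 2), (3, 3), (1, 2), (1, 3)} : Finset (ZMod q × ZMod q)).card ≤ 5 :=
    Finset.card_le_five
  have h4 := h1.trans ((Finset.card_union_le _ _).trans
    (Nat.add_le_add_left ((Finset.card_union_le _ _).trans (Nat.add_le_add h2 h3)) _))
  rw [sq]
  omega

end ReservedClasses

theorem abs_card_filter_mem_sub_le {V L : Type*} [DecidableEq L] (S : Finset V) (ℓ : V → L)
    (T : Finset L) {a t : ℝ}
    (h : ∀ l, |((S.filter fun v => ℓ v = l).card : ℝ) - a| ≤ t) :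
    |((S.filter fun v => ℓ v ∈ T).card : ℝ) - T.card * a| ≤ T.card * t := by
  have h1 : ((S.filter fun v => ℓ v ∈ T).card : ℝ) =
      ∑ l ∈ T, ((S.filter fun v => ℓ v = l).card : ℝ) := by
    rw [Finset.card_eq_sum_card_fiberwise (f := ℓ) (t := T)
      (fun v hv => by simpa using And.right (by simpa using hv))]
    push_cast
    refine Finset.sum_congr rfl fun l hl => ?_
    congr 2
    ext v
    simp only [Finset.mem_filter]
    constructor
    · rintro ⟨⟨h1, _⟩, h2⟩; exact ⟨h1, h2⟩
    · rintro ⟨h1, rfl⟩; exact ⟨⟨h1, hl⟩, rfl⟩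
  rw [h1, ← nsmul_eq_mul, ← Finset.sum_const, ← Finset.sum_sub_distrib, ← nsmul_eq_mul,
    ← Finset.sum_const]
  exact (Finset.abs_sum_le_sum_abs _ _).trans (Finset.sum_le_sum fun l _ => h l)

section

variable {V Γ : Type*} [Fintype V] [AddCommGroup Γ] [Fintype Γ] [DecidableEq Γ] {k : ℕ}
  {G : V → V → Prop} {ℓ : V → ZMod k × Γ} {κ : Γ → ℕ} {a t : ℝ}

theorem abs_card_filter_clusterEdge_sub_le
    (h : ∀ p l, |(((nbhd G p).filter fun v => ℓ v = l).card : ℝ) - a| ≤ t) (d : ZMod k) (u : V) :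
    |((Finset.univ.filter fun w => ClusterEdge G ℓ κ d u w).card : ℝ) -
      (Finset.univ.filter fun g => κ g = 0).card * a| ≤
        (Finset.univ.filter fun g => κ g = 0).card * t := by
  have h1 := abs_card_filter_mem_sub_le _ _
    ((Finset.univ.filter fun g => κ g = 0).image fun g => ((ℓ u).1 + d, (ℓ u).2 + g)) (h (u, true))
  rw [Finset.card_image_of_injective _ fun g g' e => by simpa using e] at h1
  convert h1 using 5
  ext w
  simp only [nbhd, Finset.mem_filter, Finset.mem_univ, true_and, Finset.mem_image, if_true]
  unfold ClusterEdge
  refine and_congr_right fun _ => ⟨fun ⟨h1, h2⟩ => ⟨_, h2, by rw [← h1, add_sub_cancel]⟩, ?_⟩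
  rintro ⟨g, hg, e⟩
  simp [← e, hg]

theorem abs_card_filter_clusterEdge_sub_le'
    (h : ∀ p l, |(((nbhd G p).filter fun v => ℓ v = l).card : ℝ) - a| ≤ t) (d : ZMod k) (w : V) :
    |((Finset.univ.filter fun u => ClusterEdge G ℓ κ d u w).card : ℝ) -
      (Finset.univ.filter fun g => κ g = 0).card * a| ≤
        (Finset.univ.filter fun g => κ g = 0).card * t := by
  have h1 := abs_card_filter_mem_sub_le _ _
    ((Finset.univ.filter fun g => κ g = 0).image fun g => ((ℓ w).1 - d, (ℓ w).2 - g)) (h (w, false))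
  rw [Finset.card_image_of_injective _ fun g g' e => by simpa using e] at h1
  convert h1 using 5
  ext u
  simp only [nbhd, Finset.mem_filter, Finset.mem_univ, true_and, Finset.mem_image,
    Bool.false_eq_true, if_false]
  unfold ClusterEdge
  refine and_congr_right fun _ => ⟨fun ⟨h1, h2⟩ => ⟨_, h2, ?_⟩, ?_⟩
  · rw [h1, add_sub_cancel_right, sub_sub_cancel]
  rintro ⟨g, hg, e⟩
  simp [← e, hg]

end

theorem card_filter_fst_label_le {V Γ : Type*} [Fintype V] [Fintype Γ] [DecidableEq Γ] {k : ℕ}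
    {ℓ : V → ZMod k × Γ} {a t : ℝ}
    (h : ∀ l, |((Finset.univ.filter fun v => ℓ v = l).card : ℝ) - a| ≤ t) (X : ZMod k) :
    ((Finset.univ.filter fun v => (ℓ v).1 = X).card : ℝ) ≤ Fintype.card Γ * (a + t) := by
  have h1 := abs_card_filter_mem_sub_le _ _ ({X} ×ˢ (Finset.univ : Finset Γ)) h
  rw [Finset.card_product, Finset.card_singleton, one_mul, Finset.card_univ] at h1
  have h2 : (Finset.univ.filter fun v => ℓ v ∈ {X} ×ˢ (Finset.univ : Finset Γ)) =
      Finset.univ.filter fun v => (ℓ v).1 = X := by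
    ext v; simp [Prod.ext_iff, eq_comm]
  rw [h2] at h1
  linarith [le_abs_self (((Finset.univ.filter fun v => (ℓ v).1 = X).card : ℝ) - Fintype.card Γ * a)]

/-- Regular tournaments have many edge-disjoint Hamilton cycles, conditional on relations between
the parameters. -/
theorem exists_hamilton_cycles_of_parameters {V : Type*} [Fintype V] [Nonempty V]
    {G : V → V → Prop} (hG : ∀ v, ¬ G v v) (hT : ∀ u v, u ≠ v → (G u v ↔ ¬ G v u)) {d : ℕ}
    (hd : ∀ v, outDeg G v = d) (hd' : ∀ v, inDeg G v = d) (hn : Fintype.card V = 2 * d + 1)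
    (hd7 : 7 ≤ d) {q : ℕ} (hq : 7 ≤ q) {k r s D P Q M : ℕ} [Fact k.Prime] [NeZero r]
    [NeZero q] (hM : M = (Finset.univ.filter fun g : ZMod q × ZMod q => reservedClass g = 0).card)
    {K t b e γ : ℝ} (hK : K = k * q ^ 2) (ht : 0 ≤ t)
    (hexp : 18 * (Fintype.card V : ℝ) ^ 2 * K * Real.exp (-2 * t ^ 2 / Fintype.card V) < 1)
    (hr : M * (d / K + t) ≤ (k * r : ℕ)) (hD : ((k * r : ℕ) : ℝ) ≤ M * (d / K - t) + D)
    (hb : q ^ 2 * (Fintype.card V / K + t) ≤ b)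
    (he : e ≤ (Fintype.card V : ℝ) ^ 2 / (150 * K ^ 2) - 2 * t * Fintype.card V) (hγ : 0 ≤ γ)
    (hs : 1 ≤ s) (hsk : s + 1 ≤ k)
    (hexp' : ((k * r : ℕ) + (k * r : ℕ) * (Fintype.card V : ℝ)) * Real.exp (-2 * γ ^ 2 * k) < 1)
    (hP : b + (Fintype.card V * D / (k * r : ℕ) + γ * k * b) ≤ P) (hP' : (k - 1) * (r + D) ≤ P)
    (hQ : s * b ≤ Q) (hQ' : (k - 1) * (s * r) ≤ Q)
    (hlink : ((P * (6 * Fintype.card V + (k - 1) * (k * r)) : ℕ) : ℝ) < (s : ℝ) ^ 2 * e)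
    (hins : 3 * (Q : ℝ) < ((k - 1 - s : ℕ) : ℝ) * e / (k * r : ℕ) - γ * k * b) :
    ∃ σ : {d : ZMod k // d ≠ 0} × (ZMod k × ZMod r) → Equiv.Perm V, (∀ i, IsHamCycle G (σ i)) ∧
      ∀ i j, i ≠ j → ∀ v, σ i v ≠ σ j v := by
  have hk : 0 < k := (Fact.out : k.Prime).pos
  have hK0 : 0 < K := by rw [hK]; positivity
  have hcard : (Fintype.card (ZMod k × (ZMod q × ZMod q)) : ℝ) = K := by
    rw [Fintype.card_prod, Fintype.card_prod, ZMod.card, ZMod.card, hK]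
    push_cast
    ring
  obtain ⟨ℓ, h1, h2, h3⟩ := exists_regular_labelling (L := ZMod k × (ZMod q × ZMod q)) hG hT hd hd'
    hn hd7 ht (by rw [hcard]; exact hexp)
  simp only [hcard] at h1 h2 h3
  have hb0 : 0 < b := lt_of_lt_of_le (by positivity) hb
  have h1' : ∀ l, |((Finset.univ.filter fun v => ℓ v = l).card : ℝ) - Fintype.card V / K| ≤ t :=
    fun l => by convert h1 l
  have h2' : ∀ p l, |(((nbhd G p).filter fun v => ℓ v = l).card : ℝ) - d / K| ≤ t :=
    fun p l => by convert h2 p l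
  have hout := abs_card_filter_clusterEdge_sub_le (κ := reservedClass) h2'
  have hin := abs_card_filter_clusterEdge_sub_le' (κ := reservedClass) h2'
  rw [← hM] at hout hin
  refine exists_hamilton_cycles_of_labelling (D := D) (P := P) (Q := Q) (s := s) (e := e) G hG ℓ
    reservedClass (exists_reservedClass_path hq) (exists_reservedClass_triangle hq) hb0 hγ
    (fun X => ?_) (fun d _ u => ?_) (fun d _ u => ?_) (fun d _ u => ?_) (fun d _ u => ?_)
    (fun u v l m => ?_) (fun v l m => ?_) hs hsk hexp' hP hP' hQ hQ' hlink hins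
  · refine (card_filter_fst_label_le h1' X).trans (le_trans (le_of_eq ?_) hb)
    rw [Fintype.card_prod, ZMod.card]
    push_cast
    ring
  · have := abs_le.1 (hout d u)
    rw [← Nat.cast_le (α := ℝ)]
    linarith
  · have := abs_le.1 (hin d u)
    rw [← Nat.cast_le (α := ℝ)]
    linarith
  · have := abs_le.1 (hout d u)
    rw [← Nat.cast_le (α := ℝ), Nat.cast_add]
    linarith
  · have := abs_le.1 (hin d u)
    rw [← Nat.cast_le (α := ℝ), Nat.cast_add]
    linarith
  · refine he.trans ((h3 (u, true) (v, false) l m).trans (le_of_eq ?_))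
    congr 2
    ext z
    simp [nbhd]
  · refine he.trans ((h3 (v, false) (v, true) l m).trans (le_of_eq ?_))
    congr 2
    ext z
    simp [nbhd]

theorem sparse_degree_bounds {n d k q M t K R : ℝ} (hk : 8 ≤ k) (hq : 7 ≤ q) (hn : n = 2 * d + 1)
    (hK : K = k * q ^ 2) (ht : t = n / (600 * k ^ 2 * q ^ 4)) (hM : q ^ 2 ≤ M + (2 * q + 5))
    (hM' : M ≤ q ^ 2) (hkn : 1200 * k ^ 3 * q ^ 2 ≤ n) (hR : M * (d / K + t) ≤ R)
    (hR' : R ≤ M * (d / K + t) + k) :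
    M * t ≤ n / (600 * k ^ 2) ∧ k ≤ n / (1200 * k ^ 2) ∧ R ≤ n / k ∧ n / (6 * k) ≤ R := by
  have hk0 : 0 < k := by linarith
  have hq0 : 0 < q := by linarith
  have hq1 : 1 ≤ q ^ 2 := by nlinarith
  have hk3 : 512 ≤ k ^ 3 := by
    calc (512 : ℝ) = 8 ^ 3 := by norm_num
      _ ≤ k ^ 3 := by gcongr
  have hn0 : 1200 ≤ n := by nlinarith
  have hM0 : q ^ 2 / 2 ≤ M := by nlinarith
  have h1 : M * t ≤ n / (600 * k ^ 2) := by
    calc M * t ≤ q ^ 2 * (n / (600 * k ^ 2 * q ^ 4)) := by rw [ht]; gcongr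
      _ = n / (600 * k ^ 2) / q ^ 2 := by field_simp
      _ ≤ n / (600 * k ^ 2) := div_le_self (by positivity) hq1
  have h2 : k ≤ n / (1200 * k ^ 2) := by
    rw [le_div_iff₀ (by positivity)]
    nlinarith [show k * (1200 * k ^ 2) ≤ 1200 * k ^ 3 * q ^ 2 by nlinarith [pow_pos hk0 3]]
  have h3 : n / (600 * k ^ 2) ≤ n / (4800 * k) := by
    apply div_le_div_of_nonneg_left (by linarith) (by positivity)
    nlinarith
  have h4 : n / (1200 * k ^ 2) ≤ n / (4800 * k) := by
    apply div_le_div_of_nonneg_left (by linarith) (by positivity)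
    nlinarith
  have h5 : M * (d / K) ≤ n / (2 * k) := by
    calc M * (d / K) ≤ q ^ 2 * (n / 2 / (k * q ^ 2)) := by
          rw [hK]
          gcongr
          · apply div_nonneg <;> [linarith; positivity]
          · linarith
      _ = n / (2 * k) := by field_simp
  have h6 : n / (6 * k) ≤ M * (d / K) := by
    calc n / (6 * k) = q ^ 2 / 2 * (n / 3 / (k * q ^ 2)) := by field_simp; norm_num
      _ ≤ M * (d / K) := by
          rw [hK]
          gcongr
          · linarith [sq_nonneg q]
          · linarith
  have h7 : 0 ≤ M * t := by
    have : 0 ≤ t := by rw [ht]; positivity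
    nlinarith
  refine ⟨h1, h2, ?_, ?_⟩
  · have e1 : n / (2 * k) = n / k / 2 := by field_simp
    have e2 : n / (4800 * k) = n / k / 4800 := by field_simp
    have : 0 ≤ n / k := by positivity
    rw [mul_add] at hR'
    linarith
  · rw [mul_add] at hR
    linarith

theorem linking_bound {n k q γ δ P S s e : ℝ} (hn : 0 < n) (hk : 0 < k) (hq : 0 < q) (hδ : 0 < δ)
    (hγ : 9000 * γ * q ^ 4 = δ ^ 2) (hP : P ≤ 4 * γ * n) (hS : S ≤ n) (hs : δ * k ≤ s)
    (he : e = n ^ 2 / (300 * k ^ 2 * q ^ 4)) (hγ0 : 0 < γ)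
    (hS0 : 0 ≤ S) :
    P * (6 * n + S) < s ^ 2 * e := by
  have h1 : (δ * k) ^ 2 * e ≤ s ^ 2 * e := by
    have : 0 ≤ e := by rw [he]; positivity
    gcongr
  have h2 : (δ * k) ^ 2 * e = 30 * γ * n ^ 2 := by
    rw [he, mul_pow, ← hγ]
    field_simp
    norm_num
  have h3 : P * (6 * n + S) ≤ 28 * γ * n ^ 2 := by
    calc P * (6 * n + S) ≤ (4 * γ * n) * (6 * n + n) := by gcongr
      _ = _ := by ring
  nlinarith [mul_pos hγ0 (sq_pos_of_pos hn)]

theorem insertion_bound {n k q γ δ Q R b e m : ℝ} (hn : 0 < n) (hk : 0 < k) (hq : 1 ≤ q)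
    (hδ : 12000 * δ * q ^ 4 = 1) (hγ : 9000 * γ * q ^ 4 = δ ^ 2) (hQ : Q ≤ 5 * δ * n) (hR0 : 0 < R)
    (hR : R ≤ n / k) (he : e = n ^ 2 / (300 * k ^ 2 * q ^ 4)) (hb : b = 2 * n / k)
    (hm : k / 2 ≤ m) : 3 * Q < m * e / R - γ * k * b := by
  have hq4 : 1 ≤ q ^ 4 := one_le_pow₀ hq
  have hδ0 : 0 < δ := by
    by_contra h
    nlinarith
  have hδ1 : δ ≤ 1 := by nlinarith
  have hγδ : 9000 * γ ≤ δ := by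
    by_cases h : 0 ≤ γ
    · nlinarith
    · nlinarith
  have h1 : 20 * δ * n ≤ m * e / R := by
    have e1 : 20 * δ * n = k / 2 * e / (n / k) := by
      have : δ = 1 / (12000 * q ^ 4) := by rw [eq_div_iff (by positivity)]; linarith
      rw [this, he]
      field_simp
      norm_num
    have he0 : 0 ≤ e := by rw [he]; positivity
    have hm0 : 0 ≤ m := by linarith
    rw [e1]
    gcongr
  have h2 : γ * k * b = 2 * γ * n := by rw [hb]; field_simp
  rw [h2]
  nlinarith [mul_pos hδ0 hn]

theorem labelling_exp_bound {n k q y t : ℝ} (hq : 1 ≤ q) (hy : 1 ≤ y) (hn : n = y ^ 10)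
    (hk : 0 < k) (hk' : k ≤ 2 * y) (ht : t = n / (600 * k ^ 2 * q ^ 4))
    (hE : 36 * q ^ 2 * y ^ 21 * Real.exp (-(1 / (2880000 * q ^ 8)) * y) < 1) :
    18 * n ^ 2 * (k * q ^ 2) * Real.exp (-2 * t ^ 2 / n) < 1 := by
  have hq0 : 0 < q := by linarith
  have hy0 : 0 < y := by linarith
  refine lt_of_le_of_lt ?_ hE
  refine mul_le_mul ?_ ?_ (Real.exp_pos _).le (by positivity)
  · calc 18 * n ^ 2 * (k * q ^ 2) ≤ 18 * (y ^ 10) ^ 2 * (2 * y * q ^ 2) := by rw [hn]; gcongr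
      _ = 36 * q ^ 2 * y ^ 21 := by ring
  · apply Real.exp_le_exp.2
    have h1 : 2 * t ^ 2 / n = y ^ 10 / (180000 * k ^ 4 * q ^ 8) := by
      rw [ht, hn]
      field_simp
      norm_num
    have h2 : 1 / (2880000 * q ^ 8) * y ≤ y ^ 10 / (180000 * k ^ 4 * q ^ 8) := by
      calc 1 / (2880000 * q ^ 8) * y ≤ y ^ 5 * (1 / (2880000 * q ^ 8) * y) :=
            le_mul_of_one_le_left (by positivity) (one_le_pow₀ hy)
        _ = y ^ 10 / (180000 * (2 * y) ^ 4 * q ^ 8) := by field_simp; norm_num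
        _ ≤ y ^ 10 / (180000 * k ^ 4 * q ^ 8) := by gcongr
    have h3 : -2 * t ^ 2 / n = -(2 * t ^ 2 / n) := by ring
    rw [h3, h1]
    linarith

theorem colouring_exp_bound {n k y γ R : ℝ} (hy : 1 ≤ y) (hn : n = y ^ 10) (hk : y ≤ k)
    (hR : R ≤ n) (hE : 2 * y ^ 20 * Real.exp (-(2 * γ ^ 2) * y) < 1) :
    (R + R * n) * Real.exp (-2 * γ ^ 2 * k) < 1 := by
  have hn1 : 1 ≤ n := by rw [hn]; exact one_le_pow₀ hy
  refine lt_of_le_of_lt ?_ hE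
  refine mul_le_mul ?_ ?_ (Real.exp_pos _).le (by positivity)
  · have : 2 * y ^ 20 = 2 * n ^ 2 := by rw [hn]; ring
    rw [this]
    nlinarith
  · apply Real.exp_le_exp.2
    nlinarith [sq_nonneg γ, mul_le_mul_of_nonneg_left hk (sq_nonneg γ)]

set_option maxHeartbeats 1000000 in
/-- Regular tournaments on sufficiently many vertices, measured by `y`, have many edge-disjoint
Hamilton cycles. -/
theorem exists_hamilton_cycles_of_card_eq_pow {V : Type*} [Fintype V] [Nonempty V]
    {G : V → V → Prop} (hG : ∀ v, ¬ G v v) (hT : ∀ u v, u ≠ v → (G u v ↔ ¬ G v u)) {d : ℕ}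
    (hd : ∀ v, outDeg G v = d) (hd' : ∀ v, inDeg G v = d) (hn : Fintype.card V = 2 * d + 1)
    {q k M : ℕ} (hq : 7 ≤ q) [Fact k.Prime] [NeZero q]
    (hM : M = (Finset.univ.filter fun g : ZMod q × ZMod q => reservedClass g = 0).card)
    {y γ δ : ℝ} (hδ : 12000 * δ * (q : ℝ) ^ 4 = 1) (hγ : 9000 * γ * (q : ℝ) ^ 4 = δ ^ 2)
    (hy : 1 ≤ y) (hny : (Fintype.card V : ℝ) = y ^ 10) (hky : y ≤ k) (hky' : k ≤ 2 * y)
    (hγy : 8 ≤ γ * y) (hqy : 9600 * y ^ 3 * (q : ℝ) ^ 2 ≤ y ^ 10)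
    (hE : 36 * (q : ℝ) ^ 2 * y ^ 21 * Real.exp (-(1 / (2880000 * (q : ℝ) ^ 8)) * y) < 1)
    (hE' : 2 * y ^ 20 * Real.exp (-(2 * γ ^ 2) * y) < 1) :
    ∃ H : Finset (Equiv.Perm V), (∀ σ ∈ H, IsHamCycle G σ) ∧
      (∀ σ ∈ H, ∀ τ ∈ H, σ ≠ τ → ∀ v, σ v ≠ τ v) ∧
      ((k : ℝ) - 1) * (M * (d / (k * (q : ℝ) ^ 2))) ≤ H.card := by
  obtain ⟨n, hn_def⟩ : ∃ n : ℝ, n = (Fintype.card V : ℝ) := ⟨_, rfl⟩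
  rw [← hn_def] at hny
  have hnd : n = 2 * d + 1 := by rw [hn_def, hn]; push_cast; ring
  have hq' : (7 : ℝ) ≤ q := by exact_mod_cast hq
  have hq4 : (1 : ℝ) ≤ (q : ℝ) ^ 4 := one_le_pow₀ (by linarith)
  have hM1 : (q : ℝ) ^ 2 ≤ M + (2 * q + 5) := by
    have := sq_le_card_filter_reservedClass_eq_zero (q := q)
    rw [← hM] at this
    exact_mod_cast this
  have hM2 : (M : ℝ) ≤ (q : ℝ) ^ 2 := by
    have : M ≤ q ^ 2 := by
      rw [hM]
      refine (Finset.card_le_univ _).trans_eq ?_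
      rw [Fintype.card_prod, ZMod.card, sq]
    exact_mod_cast this
  have hδ0 : 0 < δ := by
    by_contra h
    nlinarith only [h, hδ, hq4]
  have hδ1 : 12000 * δ ≤ 1 := by nlinarith only [hδ, hδ0, hq4]
  have hγ0 : 0 < γ := by
    by_contra h
    nlinarith only [h, hγ, hq4, pow_pos hδ0 2]
  have hγδ : 9000 * γ ≤ δ := by nlinarith only [hγ, hδ1, hδ0, hγ0, hq4]
  have hγk : 8 ≤ γ * k := hγy.trans (by gcongr)
  have hδk : 8 ≤ δ * k := hγk.trans (by gcongr; linarith)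
  have hk8 : (8 : ℝ) ≤ k := hδk.trans (mul_le_of_le_one_left (by positivity) (by linarith))
  have hk0 : (0 : ℝ) < k := by linarith
  have hkn : 1200 * (k : ℝ) ^ 3 * (q : ℝ) ^ 2 ≤ n := by
    rw [hny]
    refine le_trans ?_ hqy
    calc 1200 * (k : ℝ) ^ 3 * (q : ℝ) ^ 2 ≤ 1200 * (2 * y) ^ 3 * (q : ℝ) ^ 2 := by gcongr
      _ = _ := by ring
  have hn1200 : 1200 * (k : ℝ) ^ 3 ≤ n := by
    refine le_trans ?_ hkn
    exact le_mul_of_one_le_right (by positivity) (one_le_pow₀ (by linarith))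
  have hkk : (k : ℝ) ≤ (k : ℝ) ^ 3 := le_self_pow₀ (by linarith) (by norm_num)
  have hn0 : 0 < n := by linarith
  obtain ⟨t, ht⟩ : ∃ t : ℝ, t = n / (600 * (k : ℝ) ^ 2 * (q : ℝ) ^ 4) := ⟨_, rfl⟩
  obtain ⟨K, hK⟩ : ∃ K : ℝ, K = k * (q : ℝ) ^ 2 := ⟨_, rfl⟩
  obtain ⟨e, he⟩ : ∃ e : ℝ, e = n ^ 2 / (300 * (k : ℝ) ^ 2 * (q : ℝ) ^ 4) := ⟨_, rfl⟩
  obtain ⟨b, hb⟩ : ∃ b : ℝ, b = 2 * n / k := ⟨_, rfl⟩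
  have ht0 : 0 < t := by rw [ht]; positivity
  have hM0 : (0 : ℝ) < M := by nlinarith only [hM1, hq']
  obtain ⟨r, hr⟩ : ∃ r : ℕ, r = ⌈M * (d / K + t) / k⌉₊ := ⟨_, rfl⟩
  have hrpos : 0 < M * (d / K + t) / k := by
    have : 0 ≤ d / K := by rw [hK]; positivity
    positivity
  have : NeZero r := ⟨by rw [hr]; exact (Nat.ceil_pos.2 hrpos).ne'⟩
  have hR1 : M * (d / K + t) ≤ k * r := by
    rw [← div_le_iff₀' hk0, hr]
    exact Nat.le_ceil _
  have hR2 : (k : ℝ) * r ≤ M * (d / K + t) + k := by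
    have := (Nat.ceil_lt_add_one hrpos.le).le
    rw [← hr] at this
    calc (k : ℝ) * r ≤ k * (M * (d / K + t) / k + 1) := by gcongr
      _ = _ := by field_simp
  obtain ⟨hMt, hkk2, hR3, hR4⟩ := sparse_degree_bounds hk8 hq' hnd hK ht hM1 hM2 hkn hR1 hR2
  have hR0 : (0 : ℝ) < k * r := lt_of_lt_of_le (by positivity) hR4
  have hRn : (k : ℝ) * r ≤ n := hR3.trans (div_le_self hn0.le (by linarith))
  obtain ⟨D, hD⟩ : ∃ D : ℕ, D = ⌈2 * (M * t) + k⌉₊ := ⟨_, rfl⟩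
  have hD1 : 2 * (M * t) + k ≤ D := by rw [hD]; exact Nat.le_ceil _
  have hD2 : (D : ℝ) ≤ n / (k : ℝ) ^ 2 := by
    have h1 : (D : ℝ) ≤ 2 * (M * t) + k + 1 := by
      rw [hD]; exact (Nat.ceil_lt_add_one (by positivity)).le
    have e1 : n / (600 * (k : ℝ) ^ 2) = n / (k : ℝ) ^ 2 / 600 := by field_simp
    have e2 : n / (1200 * (k : ℝ) ^ 2) = n / (k : ℝ) ^ 2 / 1200 := by field_simp
    have : 0 ≤ n / (k : ℝ) ^ 2 := by positivity
    linarith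
  obtain ⟨P, hP⟩ : ∃ P : ℕ, P = ⌈3 * γ * n⌉₊ := ⟨_, rfl⟩
  obtain ⟨Q, hQ⟩ : ∃ Q : ℕ, Q = ⌈4 * δ * n⌉₊ := ⟨_, rfl⟩
  obtain ⟨s, hs⟩ : ∃ s : ℕ, s = ⌈δ * k⌉₊ := ⟨_, rfl⟩
  have hγn : 1 ≤ γ * n := by
    have : γ * y ≤ γ * n := by
      rw [hny]
      gcongr
      exact le_self_pow₀ hy (by norm_num)
    linarith
  have hδn : 1 ≤ δ * n := by
    have : γ * n ≤ δ * n := by gcongr; linarith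
    linarith
  have hP1 : 3 * γ * n ≤ P := by rw [hP]; exact Nat.le_ceil _
  have hP2 : (P : ℝ) ≤ 4 * γ * n := by
    have : (P : ℝ) ≤ 3 * γ * n + 1 := by rw [hP]; exact (Nat.ceil_lt_add_one (by positivity)).le
    linarith
  have hQ1 : 4 * δ * n ≤ Q := by rw [hQ]; exact Nat.le_ceil _
  have hQ2 : (Q : ℝ) ≤ 5 * δ * n := by
    have : (Q : ℝ) ≤ 4 * δ * n + 1 := by rw [hQ]; exact (Nat.ceil_lt_add_one (by positivity)).le
    linarith
  have hs1 : δ * k ≤ s := by rw [hs]; exact Nat.le_ceil _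
  have hs2 : (s : ℝ) ≤ 2 * δ * k := by
    have : (s : ℝ) ≤ δ * k + 1 := by rw [hs]; exact (Nat.ceil_lt_add_one (by positivity)).le
    linarith
  have hsk : 4 * (s : ℝ) ≤ k := by nlinarith only [hs2, hδ1, hδ0, hk0]
  have hskn : s + 1 ≤ k := by
    have : (s : ℝ) + 1 ≤ k := by linarith
    exact_mod_cast this
  have hk1 : ((k - 1 : ℕ) : ℝ) = k - 1 := by rw [Nat.cast_sub (by omega)]; simp
  have hks : ((k - 1 - s : ℕ) : ℝ) = k - 1 - s := by
    rw [Nat.cast_sub (by omega), hk1]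
  have hnk : n / k * k = n := by field_simp
  have hnkγ : 8 * (n / k) ≤ γ * n := by
    have : 8 * (n / k) ≤ γ * k * (n / k) := by gcongr
    calc 8 * (n / k) ≤ γ * k * (n / k) := this
      _ = γ * n := by field_simp
  have hdn : 7 ≤ d := by
    have : (7 : ℝ) ≤ d := by linarith
    exact_mod_cast this
  have hK2 : K ^ 2 = (k : ℝ) ^ 2 * (q : ℝ) ^ 4 := by rw [hK]; ring
  obtain ⟨σ, hσ1, hσ2⟩ := exists_hamilton_cycles_of_parameters (r := r) (s := s) (D := D) (P := P)
    (Q := Q) (K := K) (t := t) (b := b) (e := e) (γ := γ) hG hT hd hd' hn hdn hq hM hK ht0.le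
    (by rw [hK, ← hn_def]; exact labelling_exp_bound (by linarith) hy hny hk0 hky' ht hE)
    (by push_cast; exact hR1) (by push_cast; linarith)
    (by
      rw [← hn_def]
      have e1 : (q : ℝ) ^ 2 * (n / K) = n / k := by rw [hK]; field_simp
      have e2 : (q : ℝ) ^ 2 * t ≤ n / k := by
        have : (q : ℝ) ^ 2 * t = n / k / (600 * k * (q : ℝ) ^ 2) := by rw [ht]; field_simp
        rw [this]
        have h1 : (1 : ℝ) ≤ (q : ℝ) ^ 2 := one_le_pow₀ (by linarith)
        have h2 : 1 * 1 ≤ 600 * k * (q : ℝ) ^ 2 := mul_le_mul (by linarith) h1 (by simp) (by simp)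
        exact div_le_self (by positivity) (by linarith)
      rw [hb, mul_add, e1, mul_div_assoc]
      linarith)
    (by
      rw [← hn_def, hK2, he, ht]
      have e1 : n ^ 2 / (300 * (k : ℝ) ^ 2 * (q : ℝ) ^ 4) =
          n ^ 2 / (150 * ((k : ℝ) ^ 2 * (q : ℝ) ^ 4)) -
            2 * (n / (600 * (k : ℝ) ^ 2 * (q : ℝ) ^ 4)) * n := by field_simp; norm_num
      exact e1.le)
    hγ0.le (by rw [hs]; exact Nat.ceil_pos.2 (by positivity)) hskn
    (by
      rw [← hn_def]
      push_cast
      exact colouring_exp_bound hy hny hky hRn hE')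
    (by
      rw [← hn_def]
      push_cast
      have h1 : n * D / (k * r) ≤ 6 * (n / k) := by
        rw [div_le_iff₀ hR0]
        calc n * D ≤ n * (n / (k : ℝ) ^ 2) := by gcongr
          _ = 6 * (n / k) * (n / (6 * k)) := by field_simp
          _ ≤ _ := by gcongr
      have h2 : γ * k * b = 2 * γ * n := by rw [hb]; field_simp
      have h3 : b = 2 * (n / k) := by rw [hb]; ring
      rw [h2, h3]
      linarith)
    (by
      rw [← Nat.cast_le (α := ℝ)]
      push_cast
      rw [hk1]
      have h1 : (k : ℝ) * D ≤ n / k := by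
        calc (k : ℝ) * D ≤ k * (n / (k : ℝ) ^ 2) := by gcongr
          _ = n / k := by field_simp
      have : 0 ≤ n / k := by positivity
      linarith [Nat.cast_nonneg (α := ℝ) r, Nat.cast_nonneg (α := ℝ) D])
    (by
      refine le_trans ?_ hQ1
      calc s * b ≤ 2 * δ * k * b := by
            have : 0 ≤ b := by rw [hb]; positivity
            gcongr
        _ = 4 * δ * n := by rw [hb]; field_simp; norm_num)
    (by
      rw [← Nat.cast_le (α := ℝ)]
      push_cast
      rw [hk1]
      refine le_trans ?_ hQ1
      calc ((k : ℝ) - 1) * (s * r) ≤ s * (k * r) := by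
            linarith [show (0 : ℝ) ≤ s * r by positivity]
        _ ≤ 2 * δ * k * (n / k) := by gcongr
        _ = 2 * δ * n := by field_simp
        _ ≤ 4 * δ * n := by gcongr; norm_num)
    (by
      push_cast
      rw [← hn_def]
      refine linking_bound (k := k) (q := q) (γ := γ) (δ := δ) hn0 hk0 (by linarith) hδ0 hγ hP2 ?_
        hs1 he hγ0 ?_
      · rw [hk1]
        calc ((k : ℝ) - 1) * (k * r) ≤ k * (n / k) := by gcongr; linarith
          _ = n := by field_simp
      · positivity)
    (by
      push_cast
      refine insertion_bound (q := q) (δ := δ) hn0 hk0 (by linarith) hδ hγ hQ2 hR0 hR3 he hb ?_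
      rw [hks]
      linarith)
  have hinj : Function.Injective σ := by
    intro i j h
    by_contra hij
    exact hσ2 i j hij (Classical.arbitrary V) (by rw [h])
  refine ⟨Finset.univ.image σ, ?_, ?_, ?_⟩
  · intro τ hτ
    obtain ⟨i, -, rfl⟩ := Finset.mem_image.1 hτ
    exact hσ1 i
  · intro τ hτ τ' hτ' hne
    obtain ⟨i, -, rfl⟩ := Finset.mem_image.1 hτ
    obtain ⟨j, -, rfl⟩ := Finset.mem_image.1 hτ'
    exact hσ2 i j fun h => hne (by rw [h])
  · rw [Finset.card_image_of_injective _ hinj, Finset.card_univ, Fintype.card_prod,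
      Fintype.card_prod, ZMod.card, ZMod.card, Fintype.card_subtype_compl, ZMod.card,
      Fintype.card_subtype_eq]
    push_cast
    rw [hk1, ← hK]
    have h1 : M * (d / K) ≤ k * r := by
      refine le_trans ?_ hR1
      gcongr
      linarith
    have : (0 : ℝ) ≤ k - 1 := by linarith
    gcongr

theorem eventually_mul_pow_mul_exp_lt_one (C : ℝ) (m : ℕ) {c : ℝ} (hc : 0 < c) :
    ∀ᶠ y : ℝ in Filter.atTop, C * y ^ m * Real.exp (-c * y) < 1 := by
  have h := (tendsto_rpow_mul_exp_neg_mul_atTop_nhds_zero m c hc).const_mul C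
  rw [mul_zero] at h
  filter_upwards [h.eventually_lt_const one_pos] with y hy
  rwa [Real.rpow_natCast, ← mul_assoc] at hy

theorem half_sub_mul_le {η n d k q M : ℝ} (hq : 7 ≤ q) (hqη : 6 ≤ η * q) (hk : 1 ≤ k)
    (hkη : 2 ≤ η * k) (hn : 1 ≤ η * n) (hnd : n = 2 * d + 1)
    (hM : q ^ 2 ≤ M + (2 * q + 5)) (hd : 0 ≤ d) :
    (1 / 2 - η) * n ≤ (k - 1) * (M * (d / (k * q ^ 2))) := by
  have hk0 : 0 < k := by linarith
  have hq0 : 0 < q := by linarith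
  have h1 : (k - 1) * (M * (d / (k * q ^ 2))) = (1 - 1 / k) * (M / q ^ 2) * d := by
    field_simp
  have hkη' : 1 / k ≤ η / 2 := by
    rw [div_le_div_iff₀ hk0 two_pos]
    linarith
  have hqη' : 3 / q ≤ η / 2 := by
    rw [div_le_div_iff₀ hq0 two_pos]
    linarith
  have hM' : 1 - 3 / q ≤ M / q ^ 2 := by
    rw [le_div_iff₀ (by positivity)]
    have : (1 - 3 / q) * q ^ 2 = q ^ 2 - 3 * q := by field_simp
    linarith
  have h2 : (1 - 1 / k) * (1 - 3 / q) ≤ (1 - 1 / k) * (M / q ^ 2) := by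
    have : 1 / k ≤ 1 := (div_le_one hk0).2 hk
    exact mul_le_mul_of_nonneg_left hM' (by linarith)
  have h3 : 1 - η ≤ (1 - 1 / k) * (1 - 3 / q) := by
    have : 0 ≤ 1 / k * (3 / q) := by positivity
    linarith
  rw [h1]
  calc (1 / 2 - η) * n ≤ (1 - η) * d := by
        rw [hnd] at hn ⊢
        have : 0 < 1 / k := by positivity
        linarith
    _ ≤ _ := mul_le_mul_of_nonneg_right (h3.trans h2) hd

theorem eventually_parameters {η γ q : ℝ} (hη : 0 < η) (hγ : 0 < γ) (hq : 0 < q) :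
    ∀ᶠ y : ℝ in Filter.atTop, 1 ≤ y ∧ 2 ≤ η * y ∧ 8 ≤ γ * y ∧
      9600 * y ^ 3 * q ^ 2 ≤ y ^ 10 ∧
      36 * q ^ 2 * y ^ 21 * Real.exp (-(1 / (2880000 * q ^ 8)) * y) < 1 ∧
      2 * y ^ 20 * Real.exp (-(2 * γ ^ 2) * y) < 1 := by
  filter_upwards [Filter.eventually_ge_atTop 1, Filter.eventually_ge_atTop (2 / η),
    Filter.eventually_ge_atTop (8 / γ), Filter.eventually_ge_atTop (9600 * q ^ 2),
    eventually_mul_pow_mul_exp_lt_one (36 * q ^ 2) 21 (c := 1 / (2880000 * q ^ 8)) (by positivity),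
    eventually_mul_pow_mul_exp_lt_one 2 20 (c := 2 * γ ^ 2) (by positivity)]
      with y h1 h2 h3 h4 h5 h6
  refine ⟨h1, (div_le_iff₀' hη).1 h2, (div_le_iff₀' hγ).1 h3, ?_, h5, h6⟩
  calc 9600 * y ^ 3 * q ^ 2 = y ^ 3 * (9600 * q ^ 2) := by ring
    _ ≤ y ^ 3 * y := by gcongr
    _ = y ^ 4 := by ring
    _ ≤ y ^ 10 := pow_le_pow_right₀ h1 (by norm_num)

/-- every regular tournament on `n ≥ n₀` vertices contains at least
`(1/2 − η)n` pairwise edge-disjoint Hamilton cycles. -/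
theorem regular_tournament_many_edge_disjoint_hamilton_cycles :
    ∀ η : ℝ, 0 < η → ∃ n₀ : ℕ, ∀ n : ℕ, n₀ ≤ n →
    ∀ (V : Type) [Fintype V] [DecidableEq V], Fintype.card V = n →
    ∀ G : V → V → Prop,
      (∀ v, ¬ G v v) →
      (∀ u v : V, u ≠ v → (G u v ↔ ¬ G v u)) →
      (∀ v, outDeg G v = inDeg G v) →
      ∃ H : Finset (Equiv.Perm V),
        (∀ σ ∈ H, IsHamCycle G σ) ∧
        (∀ σ ∈ H, ∀ τ ∈ H, σ ≠ τ → ∀ v : V, σ v ≠ τ v) ∧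
        (1/2 - η) * (n : ℝ) ≤ (H.card : ℝ) := by
  intro η hη
  obtain ⟨q, hq⟩ := exists_nat_ge (max 7 (6 / η))
  have hq7 : (7 : ℝ) ≤ q := (le_max_left _ _).trans hq
  have hqη : 6 ≤ η * q := (div_le_iff₀' hη).1 ((le_max_right _ _).trans hq)
  have hq7' : 7 ≤ q := by exact_mod_cast hq7
  have : NeZero q := ⟨by omega⟩
  have hq0 : (0 : ℝ) < q := by linarith
  obtain ⟨δ, hδ⟩ : ∃ δ : ℝ, δ = 1 / (12000 * (q : ℝ) ^ 4) := ⟨_, rfl⟩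
  obtain ⟨γ, hγ⟩ : ∃ γ : ℝ, γ = δ ^ 2 / (9000 * (q : ℝ) ^ 4) := ⟨_, rfl⟩
  have hδ0 : 0 < δ := by rw [hδ]; positivity
  have hγ0 : 0 < γ := by rw [hγ]; positivity
  obtain ⟨y₀, hy₀⟩ := Filter.eventually_atTop.1 (eventually_parameters hη hγ0 hq0)
  refine ⟨⌈max (max y₀ 0 ^ 10) (max 1 (1 / η))⌉₊, fun n hn V _ _ hV G hG hT hdeg => ?_⟩
  have hn' : max (max y₀ 0 ^ 10) (max 1 (1 / η)) ≤ (n : ℝ) := Nat.ceil_le.1 hn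
  simp only [max_le_iff] at hn'
  obtain ⟨hny₀, hn1, hnη⟩ := hn'
  obtain ⟨y, hy0, hny⟩ : ∃ y : ℝ, 0 ≤ y ∧ (n : ℝ) = y ^ 10 :=
    ⟨(n : ℝ) ^ (((10 : ℕ) : ℝ)⁻¹), by positivity,
      (Real.rpow_inv_natCast_pow (by positivity) (by norm_num)).symm⟩
  have hyy : y₀ ≤ y := by
    rw [hny] at hny₀
    exact (le_max_left _ _).trans (le_of_pow_le_pow_left₀ (by norm_num) hy0 hny₀)
  obtain ⟨hy1, hyη, hγy, hqy, hE, hE'⟩ := hy₀ y hyy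
  obtain ⟨k, hkp, hmk, hkm⟩ := Nat.exists_prime_lt_and_le_two_mul ⌊y⌋₊ (Nat.floor_pos.2 hy1).ne'
  have : Fact k.Prime := ⟨hkp⟩
  have hyk : y ≤ k := by
    refine (Nat.lt_floor_add_one y).le.trans ?_
    exact_mod_cast hmk
  have hky : (k : ℝ) ≤ 2 * y := by
    have h1 : (k : ℝ) ≤ 2 * ⌊y⌋₊ := by exact_mod_cast hkm
    have h2 := Nat.floor_le hy0
    linarith
  have : Nonempty V := Fintype.card_pos_iff.1 (by rw [hV]; exact_mod_cast one_pos.trans_le hn1)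
  have hcard : ∀ v, 2 * outDeg G v + 1 = Fintype.card V := fun v => by
    rw [← outDeg_add_inDeg hG hT v, ← hdeg v, two_mul]
  obtain ⟨d, hd⟩ : ∃ d, d = outDeg G (Classical.arbitrary V) := ⟨_, rfl⟩
  have hVd : Fintype.card V = 2 * d + 1 := by rw [hd, hcard]
  have hd1 : ∀ v, outDeg G v = d := fun v => by
    have := hcard v
    omega
  obtain ⟨H, hH, hH', hcardH⟩ := exists_hamilton_cycles_of_card_eq_pow hG hT hd1
    (fun v => (hdeg v).symm.trans (hd1 v)) hVd hq7' rfl (y := y) (γ := γ) (δ := δ)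
    (by rw [hδ]; field_simp) (by rw [hγ]; field_simp) hy1 (by rw [hV, hny]) hyk hky hγy hqy hE hE'
  refine ⟨H, fun σ hσ => hH σ hσ, hH', le_trans ?_ hcardH⟩
  refine half_sub_mul_le hq7 hqη (hy1.trans hyk) (hyη.trans (by gcongr))
    ((div_le_iff₀' hη).1 hnη) ?_ ?_ (by positivity)
  · rw [← hV, hVd]
    push_cast
    rfl
  · have := sq_le_card_filter_reservedClass_eq_zero (q := q)
    exact_mod_cast this
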